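/- arXiv:2110.07005 — 3 statements merged into one kernel-verified Lean document; each statement's English description precedes it below -/
import Mathlib

section
/- Every finite bipartite graph G satisfies χ⃗(G) ≤ ⌈MAD(G)/2⌉ + 3. -/
open SimpleGraph Finset

/-- An orientation of a simple graph `G`: each edge gets exactly one direction. -/
structure GOrientation {V : Type*} (G : SimpleGraph V) where
  dir : V → V → Bool
  adj_iff : ∀ u v, G.Adj u v ↔ (dir u v = true ∨ dir v u = true)
  not_both : ∀ u v, ¬(dir u v = true ∧ dir v u = true)

def GOrientation.outDeg {V : Type*} [Fintype V] {G : SimpleGraph V}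
    (o : GOrientation G) (u : V) : ℕ :=
  (Finset.univ.filter fun v => o.dir u v = true).card

def GOrientation.inDeg {V : Type*} [Fintype V] {G : SimpleGraph V}
    (o : GOrientation G) (u : V) : ℕ :=
  (Finset.univ.filter fun v => o.dir v u = true).card

/-- A proper orientation: adjacent vertices get distinct outdegrees. -/
def GOrientation.IsProper {V : Type*} [Fintype V] {G : SimpleGraph V}
    (o : GOrientation G) : Prop :=
  ∀ u v, G.Adj u v → o.outDeg u ≠ o.outDeg v

/-- Maximum average degree: sup over nonempty subgraphs of 2|E(H)|/|V(H)|. -/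
noncomputable def mad {V : Type*} [Fintype V] (G : SimpleGraph V) : ℝ :=
  sSup {x : ℝ | ∃ H : G.Subgraph, H.verts.Nonempty ∧
    x = 2 * H.edgeSet.ncard / H.verts.ncard}

/-- `H` is a minor of `G`: disjoint nonempty connected branch sets with edges realized. -/
def HasMinor {V W : Type*} (G : SimpleGraph V) (H : SimpleGraph W) : Prop :=
  ∃ B : W → Set V,
    (∀ w, (B w).Nonempty) ∧
    (∀ w, (G.induce (B w)).Connected) ∧
    (∀ w₁ w₂, w₁ ≠ w₂ → Disjoint (B w₁) (B w₂)) ∧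
    (∀ w₁ w₂, H.Adj w₁ w₂ → ∃ u ∈ B w₁, ∃ v ∈ B w₂, G.Adj u v)

/-- Planarity via Wagner's theorem: no `K₅` and no `K_{3,3}` minor. -/
def IsPlanar {V : Type*} (G : SimpleGraph V) : Prop :=
  ¬ HasMinor G (completeGraph (Fin 5)) ∧
  ¬ HasMinor G (completeBipartiteGraph (Fin 3) (Fin 3))

/-- Outerplanarity: no `K₄` and no `K_{2,3}` minor. -/
def IsOuterplanar {V : Type*} (G : SimpleGraph V) : Prop :=
  ¬ HasMinor G (completeGraph (Fin 4)) ∧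
  ¬ HasMinor G (completeBipartiteGraph (Fin 2) (Fin 3))


/-- Subgraph density bound coming from `mad`. -/
theorem edges_le_mad {V : Type*} [Fintype V] (G : SimpleGraph V) (H : G.Subgraph)
    (hne : H.verts.Nonempty) :
    H.edgeSet.ncard ≤ ⌈mad G / 2⌉₊ * H.verts.ncard := by
  classical
  have hfin : Set.Finite {x : ℝ | ∃ H : G.Subgraph, H.verts.Nonempty ∧
      x = 2 * H.edgeSet.ncard / H.verts.ncard} := by
    have : Finite G.Subgraph := by infer_instance
    refine (Set.finite_range
      (fun H : G.Subgraph => (2 * H.edgeSet.ncard / H.verts.ncard : ℝ))).subset ?_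
    rintro x ⟨H, _, rfl⟩
    exact ⟨H, rfl⟩
  have h1 : (2 * H.edgeSet.ncard / H.verts.ncard : ℝ) ≤ mad G :=
    le_csSup hfin.bddAbove ⟨H, hne, rfl⟩
  have hpos : (0 : ℝ) < H.verts.ncard := by
    have := (Set.ncard_pos (Set.toFinite H.verts)).2 hne
    exact_mod_cast this
  have h2 : mad G / 2 ≤ (⌈mad G / 2⌉₊ : ℝ) := Nat.le_ceil _
  rw [div_le_iff₀ hpos] at h1
  have h3 : (H.edgeSet.ncard : ℝ) ≤ (⌈mad G / 2⌉₊ : ℝ) * H.verts.ncard := by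
    nlinarith
  exact_mod_cast h3

/-- Hakimi: there is an orientation with outdegrees at most `⌈mad/2⌉`. -/
theorem hakimi {V : Type*} [Fintype V] (G : SimpleGraph V) :
    ∃ o : GOrientation G, ∀ u, o.outDeg u ≤ ⌈mad G / 2⌉₊ := by
  classical
  set k := ⌈mad G / 2⌉₊ with hk
  have hall : ∃ f : G.edgeSet → V × Fin k, Function.Injective f ∧
      ∀ e : G.edgeSet, f e ∈ (univ.filter (fun p : V × Fin k => p.1 ∈ (e : Sym2 V))) := by
    rw [← Finset.all_card_le_biUnion_card_iff_exists_injective]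
    intro s
    let W : Finset V := univ.filter (fun v => ∃ e ∈ s, v ∈ (e : Sym2 V))
    have hbi : s.biUnion (fun e => univ.filter (fun p : V × Fin k => p.1 ∈ (e : Sym2 V)))
        = W ×ˢ univ := by
      ext p
      simp [W]
    rw [hbi, card_product, card_univ, Fintype.card_fin]
    rcases s.eq_empty_or_nonempty with rfl | ⟨e0, he0⟩
    · simp
    let H : G.Subgraph :=
      { verts := W
        Adj := fun u v => ∃ h : G.Adj u v, (⟨s(u, v), h⟩ : G.edgeSet) ∈ s
        adj_sub := fun h => h.1
        edge_vert := by
          rintro u v ⟨h, hs⟩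
          simp only [W, coe_filter, mem_univ, true_and, Set.mem_ofPred_eq]
          exact ⟨_, hs, by simp⟩
        symm := ⟨by
          rintro u v ⟨h, hs⟩
          refine ⟨h.symm, ?_⟩
          have : (⟨s(v, u), h.symm⟩ : G.edgeSet) = ⟨s(u, v), h⟩ := by
            apply Subtype.ext; exact Sym2.eq_swap
          rw [this]; exact hs⟩ }
    have hne : H.verts.Nonempty := by
      obtain ⟨⟨u, v⟩, he⟩ := e0
      refine ⟨u, ?_⟩
      simp only [H, W, coe_filter, mem_univ, true_and, Set.mem_ofPred_eq]
      exact ⟨_, he0, Sym2.mem_mk_left u v⟩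
    have hmain := edges_le_mad G H hne
    have hE : H.edgeSet = ((s.map (Function.Embedding.subtype _) : Finset (Sym2 V)) : Set (Sym2 V)) := by
      ext e
      induction e with
      | _ u v =>
        simp [H]
    have hV : H.verts = (W : Set V) := rfl
    rw [hE, hV, Set.ncard_coe_finset, Set.ncard_coe_finset, card_map] at hmain
    rw [mul_comm]
    exact hmain
  obtain ⟨f, hinj, hf⟩ := hall
  have hf' : ∀ e : G.edgeSet, (f e).1 ∈ (e : Sym2 V) := fun e => by simpa using hf e
  have hsw : ∀ u v (h : G.Adj u v), (⟨s(v, u), h.symm⟩ : G.edgeSet) = ⟨s(u, v), h⟩ := by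
    intro u v h
    apply Subtype.ext; exact Sym2.eq_swap
  refine ⟨⟨fun u v => decide (∃ h : G.Adj u v, (f ⟨s(u, v), h⟩).1 = u), ?_, ?_⟩, ?_⟩
  · intro u v
    simp only [decide_eq_true_eq]
    constructor
    · intro h
      have := hf' ⟨s(u, v), h⟩
      rcases Sym2.mem_iff.1 this with h1 | h1
      · exact Or.inl ⟨h, h1⟩
      · exact Or.inr ⟨h.symm, by rw [hsw u v h]; exact h1⟩
    · rintro (⟨h, _⟩ | ⟨h, _⟩)
      · exact h
      · exact h.symm
  · intro u v
    simp only [decide_eq_true_eq]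
    rintro ⟨⟨h, h1⟩, ⟨h', h2⟩⟩
    rw [hsw u v h] at h2
    exact h.ne (h1.symm.trans h2)
  · intro u
    unfold GOrientation.outDeg
    simp only [decide_eq_true_eq]
    let g : {v // ∃ h : G.Adj u v, (f ⟨s(u, v), h⟩).1 = u} → Fin k :=
      fun v => (f ⟨s(u, v.1), v.2.1⟩).2
    have hg : Function.Injective g := by
      rintro ⟨v, h, hv⟩ ⟨w, h', hw⟩ hvw
      have h2 : f ⟨s(u, v), h⟩ = f ⟨s(u, w), h'⟩ := Prod.ext (hv.trans hw.symm) hvw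
      have h3 := congrArg Subtype.val (hinj h2)
      simp only [Sym2.congr_right] at h3
      exact Subtype.ext h3
    have := Fintype.card_le_of_injective g hg
    rw [Fintype.card_subtype, Fintype.card_fin] at this
    exact this

/-- Reverse all edges `a → b` for `a ∈ F`. -/
def GOrientation.flip {V : Type*} [DecidableEq V] {G : SimpleGraph V}
    (o : GOrientation G) (b : V) (F : Finset V) : GOrientation G where
  dir u v := if (u = b ∧ v ∈ F) ∨ (v = b ∧ u ∈ F) then o.dir v u else o.dir u v
  adj_iff u v := by
    have h := o.adj_iff u v
    by_cases hP : (u = b ∧ v ∈ F) ∨ (v = b ∧ u ∈ F)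
    · have hP' : (v = b ∧ u ∈ F) ∨ (u = b ∧ v ∈ F) := hP.symm
      simp only [hP, hP', if_true]; rw [h]; exact or_comm
    · have hP' : ¬ ((v = b ∧ u ∈ F) ∨ (u = b ∧ v ∈ F)) := fun h => hP h.symm
      simp only [hP, hP', if_false]; exact h
  not_both u v := by
    have h := o.not_both u v
    by_cases hP : (u = b ∧ v ∈ F) ∨ (v = b ∧ u ∈ F)
    · have hP' : (v = b ∧ u ∈ F) ∨ (u = b ∧ v ∈ F) := hP.symm
      simp only [hP, hP', if_true]; exact fun h' => h h'.symm
    · have hP' : ¬ ((v = b ∧ u ∈ F) ∨ (u = b ∧ v ∈ F)) := fun h => hP h.symm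
      simp only [hP, hP', if_false]; exact h

section
variable {V : Type*} [Fintype V] [DecidableEq V] {G : SimpleGraph V}

theorem flip_outDeg_b (o : GOrientation G) (b : V) (F : Finset V)
    (hF : ∀ a ∈ F, o.dir a b = true) : (o.flip b F).outDeg b = o.outDeg b + F.card := by
  unfold GOrientation.outDeg
  rw [← card_union_of_disjoint]
  · congr 1
    ext v
    have hb : b ∉ F := fun h => o.not_both b b ⟨hF b h, hF b h⟩
    by_cases hv : v ∈ F
    · simp [GOrientation.flip, hv, hF v hv]
    · simp [GOrientation.flip, hv, hb]
  · rw [Finset.disjoint_left]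
    intro v h1 h2
    simp only [mem_filter, mem_univ, true_and] at h1
    exact o.not_both b v ⟨h1, hF v h2⟩

theorem flip_outDeg_mem (o : GOrientation G) (b : V) (F : Finset V)
    (hF : ∀ a ∈ F, o.dir a b = true) (a : V) (ha : a ∈ F) :
    (o.flip b F).outDeg a + 1 = o.outDeg a := by
  unfold GOrientation.outDeg
  have hb : b ∉ F := fun h => o.not_both b b ⟨hF b h, hF b h⟩
  have hab : a ≠ b := fun h => hb (h ▸ ha)
  have : (univ.filter fun v => (o.flip b F).dir a v = true)
      = (univ.filter fun v => o.dir a v = true).erase b := by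
    ext v
    have h2 : o.dir b a ≠ true := fun h => o.not_both a b ⟨hF a ha, h⟩
    by_cases hv : v = b
    · subst hv; simp [GOrientation.flip, ha, h2]
    · simp [GOrientation.flip, hv, hab]
  rw [this]
  apply card_erase_add_one
  simp [hF a ha]

theorem flip_outDeg_other (o : GOrientation G) (b : V) (F : Finset V)
    (a : V) (ha : a ∉ F) (hab : a ≠ b) :
    (o.flip b F).outDeg a = o.outDeg a := by
  unfold GOrientation.outDeg
  congr 1
  ext v
  simp [GOrientation.flip, ha, hab]

/-- The invariant of the flipping process. -/
structure FlipInv (A : V → Prop) (k : ℕ) (o : GOrientation G) : Prop where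
  high : ∀ a, A a → o.outDeg a = k + 2 ∨ o.outDeg a ≤ k + 1
  src : ∀ b a, ¬ A b → A a → o.dir b a = true → o.outDeg a ≤ k + 1 → o.outDeg a < o.outDeg b
  le : ∀ b, ¬ A b → o.outDeg b ≤ k + 3
  ne : ∀ b, ¬ A b → o.outDeg b ≠ k + 2
  top : ∀ a b, A a → ¬ A b → o.dir a b = true → o.outDeg b = k + 1 → o.outDeg a ≠ k + 1

theorem inv_flip (A : V → Prop) (k : ℕ) (o : GOrientation G) (h : FlipInv A k o) (b : V)
    (hb : ¬ A b) (F : Finset V) (hF : ∀ a ∈ F, o.dir a b = true)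
    (hFA : ∀ a ∈ F, A a)
    (hFlow : ∀ a ∈ F, o.outDeg a ≤ k + 1)
    (hval : ∀ a ∈ F, o.outDeg a ≤ o.outDeg b + F.card)
    (hle : o.outDeg b + F.card ≤ k + 3) (hne : o.outDeg b + F.card ≠ k + 2)
    (htop : o.outDeg b + F.card = k + 1 →
      ∀ a, A a → o.dir a b = true → o.outDeg a = k + 1 → a ∈ F) :
    FlipInv A k (o.flip b F) := by
  have hB := flip_outDeg_b o b F hF
  have hM := flip_outDeg_mem o b F hF
  have hO := flip_outDeg_other o b F
  have hbF : b ∉ F := fun h => hb (hFA b h)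
  have hOB : ∀ b', ¬ A b' → b' ≠ b → (o.flip b F).outDeg b' = o.outDeg b' :=
    fun b' h1 h2 => hO b' (fun h3 => h1 (hFA _ h3)) h2
  have hAb : ∀ a, A a → a ≠ b := fun a ha hab => hb (hab ▸ ha)
  constructor
  · intro a ha
    by_cases haF : a ∈ F
    · have := hM a haF; have := hFlow a haF; right; omega
    · rw [hO a haF (hAb a ha)]; exact h.high a ha
  · intro b' a hb' ha hd hlow
    have hab := hAb a ha
    by_cases haF : a ∈ F
    · have h1 := hM a haF
      by_cases hbb : b' = b
      · subst hbb; have := hval a haF; omega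
      · rw [hOB b' hb' hbb]
        have hd' : o.dir b' a = true := by simpa [GOrientation.flip, hbb, hab] using hd
        have := h.src b' a hb' ha hd' (hFlow a haF)
        omega
    · rw [hO a haF hab] at hlow ⊢
      have hd' : o.dir b' a = true := by simpa [GOrientation.flip, haF, hab] using hd
      have h1 := h.src b' a hb' ha hd' hlow
      by_cases hbb : b' = b
      · subst hbb; omega
      · rw [hOB b' hb' hbb]; exact h1
  · intro b' hb'
    by_cases hbb : b' = b
    · subst hbb; omega
    · rw [hOB b' hb' hbb]; exact h.le b' hb'
  · intro b' hb'
    by_cases hbb : b' = b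
    · subst hbb; omega
    · rw [hOB b' hb' hbb]; exact h.ne b' hb'
  · intro a b' ha hb' hd hk
    have hab := hAb a ha
    by_cases haF : a ∈ F
    · have h1 := hM a haF
      have := hFlow a haF
      omega
    · rw [hO a haF hab]
      have hd' : o.dir a b' = true := by simpa [GOrientation.flip, haF, hab] using hd
      by_cases hbb : b' = b
      · subst hbb
        intro h2
        exact haF (htop (by omega) a ha hd' h2)
      · rw [hOB b' hb' hbb] at hk
        exact h.top a b' ha hb' hd' hk

/-- A conflict can be removed by a flip that keeps the invariant. -/
theorem inv_step (A : V → Prop) (k : ℕ) (o : GOrientation G) (h : FlipInv A k o) (a b : V)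
    (ha : A a) (hb : ¬ A b) (hadj : G.Adj a b) (heq : o.outDeg a = o.outDeg b) :
    ∃ F : Finset V, (∀ a ∈ F, o.dir a b = true) ∧ (∀ a ∈ F, A a) ∧ 0 < F.card ∧
      FlipInv A k (o.flip b F) := by
  classical
  have hlow : o.outDeg a ≤ k + 1 := by
    rcases h.high a ha with h1 | h1
    · exact absurd (heq ▸ h1) (h.ne b hb)
    · exact h1
  have hd : o.dir a b = true := by
    rcases (o.adj_iff a b).1 hadj with h1 | h1
    · exact h1
    · have := h.src b a hb ha h1 hlow; omega
  have hk : o.outDeg a ≤ k := by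
    by_contra hc
    exact h.top a b ha hb hd (by omega) (by omega)
  let T : Finset V := univ.filter fun v => A v ∧ o.dir v b = true ∧ o.outDeg v = k + 1
  have hT : ∀ v, v ∈ T ↔ A v ∧ o.dir v b = true ∧ o.outDeg v = k + 1 := by
    intro v; simp [T]
  have single : ∀ v, A v → o.dir v b = true → o.outDeg v ≤ o.outDeg b + 1 →
      (o.outDeg b = k → ∀ w ∈ T, w = v) →
      ∃ F : Finset V, (∀ a ∈ F, o.dir a b = true) ∧ (∀ a ∈ F, A a) ∧ 0 < F.card ∧
        FlipInv A k (o.flip b F) := by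
    intro v hv hdv hle hTv
    have h1 : ∀ x ∈ ({v} : Finset V), o.dir x b = true := by
      intro x hx; rw [mem_singleton.1 hx]; exact hdv
    have h2 : ∀ x ∈ ({v} : Finset V), A x := by
      intro x hx; rw [mem_singleton.1 hx]; exact hv
    refine ⟨{v}, h1, h2, by simp, inv_flip A k o h b hb {v} h1 h2 ?_ ?_ ?_ ?_ ?_⟩
    · intro x hx; rw [mem_singleton.1 hx]; omega
    · intro x hx; rw [mem_singleton.1 hx, card_singleton]; exact hle
    · rw [card_singleton]; omega
    · rw [card_singleton]; omega
    · rw [card_singleton]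
      intro h3 x hx hdx hox
      exact mem_singleton.2 (hTv (by omega) x ((hT x).2 ⟨hx, hdx, hox⟩))
  by_cases hx : o.outDeg b = k
  · by_cases hT2 : 2 ≤ T.card
    · obtain ⟨U, hUT, hU⟩ := Finset.exists_subset_card_eq hT2
      have haU : a ∉ U := fun hh => by have := ((hT a).1 (hUT hh)).2.2; omega
      have hc : (insert a U).card = 3 := by rw [card_insert_of_notMem haU, hU]
      have h1 : ∀ x ∈ insert a U, o.dir x b = true := by
        intro x hx
        rcases mem_insert.1 hx with rfl | hx
        · exact hd
        · exact ((hT x).1 (hUT hx)).2.1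
      have h2 : ∀ x ∈ insert a U, A x := by
        intro x hx
        rcases mem_insert.1 hx with rfl | hx
        · exact ha
        · exact ((hT x).1 (hUT hx)).1
      have h3 : ∀ x ∈ insert a U, o.outDeg x ≤ k + 1 := by
        intro x hx
        rcases mem_insert.1 hx with rfl | hx
        · exact hlow
        · exact ((hT x).1 (hUT hx)).2.2.le
      refine ⟨insert a U, h1, h2, by omega, inv_flip A k o h b hb _ h1 h2 h3 ?_ ?_ ?_ ?_⟩
      · intro x hx; have := h3 x hx; omega
      · omega
      · omega
      · omega
    · rcases T.eq_empty_or_nonempty with hT0 | ⟨v, hv⟩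
      · exact single a ha hd (by omega) (fun _ w hw => by simp [hT0] at hw)
      · have hv' := (hT v).1 hv
        refine single v hv'.1 hv'.2.1 (by omega) (fun _ w hw => ?_)
        exact Finset.card_le_one.1 (by omega) w hw v hv
  · exact single a ha hd (by omega) (fun h3 => absurd h3 hx)

/-- Starting orientation. -/
theorem inv_init (A : V → Prop) (k : ℕ) (hbip : ∀ u v, G.Adj u v → (A u ↔ ¬ A v))
    (o : GOrientation G) (ho : ∀ u, o.outDeg u ≤ k) :
    ∃ o' : GOrientation G, FlipInv A k o' := by
  classical
  have hO : ∀ a, ∃ O : Finset V, (univ.filter fun v => o.dir a v = true) ⊆ O ∧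
      O ⊆ (univ.filter fun v => G.Adj a v) ∧
      O.card = min (k + 2) (univ.filter fun v => G.Adj a v).card := by
    intro a
    have hsub : (univ.filter fun v => o.dir a v = true) ⊆ (univ.filter fun v => G.Adj a v) := by
      intro v hv
      simp only [mem_filter, mem_univ, true_and] at hv ⊢
      exact (o.adj_iff a v).2 (Or.inl hv)
    have h1 := card_le_card hsub
    have h2 : (univ.filter fun v => o.dir a v = true).card ≤ k := ho a
    exact Finset.exists_subsuperset_card_eq hsub (by omega) (by omega)
  choose O hO1 hO2 hO3 using hO
  have hadjO : ∀ a v, v ∈ O a → G.Adj a v := fun a v hv => by simpa using hO2 a hv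
  let o' : GOrientation G :=
    { dir := fun u v => if A u then decide (v ∈ O u) else decide (G.Adj u v ∧ u ∉ O v)
      adj_iff := by
        intro u v
        constructor
        · intro h
          have := hbip u v h
          have h' := h.symm
          by_cases hu : A u
          · have hv : ¬ A v := this.1 hu
            simp only [hu, hv, if_true, if_false, decide_eq_true_eq, h', true_and]
            exact em _
          · have hv : A v := by tauto
            simp only [hu, hv, if_true, if_false, decide_eq_true_eq, h, true_and]
            exact (em _).symm
        · rintro (h | h)
          · by_cases hu : A u
            · simp only [hu, if_true, decide_eq_true_eq] at h; exact hadjO _ _ h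
            · simp only [hu, if_false, decide_eq_true_eq] at h; exact h.1
          · by_cases hu : A v
            · simp only [hu, if_true, decide_eq_true_eq] at h; exact (hadjO _ _ h).symm
            · simp only [hu, if_false, decide_eq_true_eq] at h; exact h.1.symm
      not_both := by
        rintro u v ⟨h1, h2⟩
        by_cases hu : A u
        · simp only [hu, if_true, decide_eq_true_eq] at h1
          have hv : ¬ A v := (hbip u v (hadjO _ _ h1)).1 hu
          simp only [hv, if_false, decide_eq_true_eq] at h2
          exact h2.2 h1
        · simp only [hu, if_false, decide_eq_true_eq] at h1
          have hv : A v := by have := hbip u v h1.1; tauto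
          simp only [hv, if_true, decide_eq_true_eq] at h2
          exact h1.2 h2 }
  have hA : ∀ a, A a → o'.outDeg a = min (k + 2) (univ.filter fun v => G.Adj a v).card := by
    intro a ha
    rw [← hO3 a]
    unfold GOrientation.outDeg
    congr 1
    ext v
    simp [o', ha]
  have hB : ∀ b, ¬ A b → o'.outDeg b ≤ k := by
    intro b hb
    refine le_trans (card_le_card ?_) (ho b)
    intro v hv
    simp only [o', hb, if_false, mem_filter, mem_univ, true_and, decide_eq_true_eq] at hv ⊢
    rcases (o.adj_iff b v).1 hv.1 with h | h
    · exact h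
    · exact absurd (hO1 v (by simpa using h)) hv.2
  refine ⟨o', ?_, ?_, ?_, ?_, ?_⟩
  · intro a ha; have := hA a ha; omega
  · intro b a hb ha hd hlow
    exfalso
    have h1 := hA a ha
    simp only [o', hb, if_false, decide_eq_true_eq] at hd
    have hsub : O a = univ.filter fun v => G.Adj a v := by
      apply Finset.eq_of_subset_of_card_le (hO2 a)
      rw [hO3 a]; omega
    apply hd.2
    rw [hsub]
    simpa using hd.1.symm
  · intro b hb; have := hB b hb; omega
  · intro b hb; have := hB b hb; omega
  · intro a b _ hb _ h1; have := hB b hb; omega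

theorem inv_final (A : V → Prop) (k : ℕ) (hbip : ∀ u v, G.Adj u v → (A u ↔ ¬ A v))
    (h0 : ∃ o : GOrientation G, FlipInv A k o) :
    ∃ o : GOrientation G, o.IsProper ∧ ∀ u, o.outDeg u ≤ k + 3 := by
  classical
  let S : GOrientation G → ℕ := fun o => ∑ b ∈ univ.filter (fun b => ¬ A b), o.outDeg b
  have hbd : ∀ o : GOrientation G, S o ≤ Fintype.card V * Fintype.card V := by
    intro o
    calc S o ≤ ∑ b ∈ univ.filter (fun b => ¬ A b), Fintype.card V :=
          sum_le_sum fun b _ => card_le_univ _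
      _ ≤ _ := by
          rw [sum_const, smul_eq_mul]
          exact Nat.mul_le_mul_right _ (card_le_univ _)
  have hex : ∃ n, ∃ o : GOrientation G, FlipInv A k o ∧ Fintype.card V * Fintype.card V - S o = n := by
    obtain ⟨o, ho⟩ := h0; exact ⟨_, o, ho, rfl⟩
  obtain ⟨o, ho, hn⟩ := Nat.find_spec hex
  have hmin : ∀ o' : GOrientation G, FlipInv A k o' → S o' ≤ S o := by
    intro o' ho'
    have := Nat.find_min' hex ⟨o', ho', rfl⟩
    have := hbd o; have := hbd o'
    omega
  have key : ∀ a b, A a → ¬ A b → G.Adj a b → o.outDeg a ≠ o.outDeg b := by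
    intro a b ha hb hadj heq
    obtain ⟨F, hF, hFA, hpos, hinv⟩ := inv_step A k o ho a b ha hb hadj heq
    have h1 := hmin _ hinv
    have h2 : S o < S (o.flip b F) := by
      apply sum_lt_sum
      · intro i hi
        have hi' : ¬ A i := by simpa using hi
        by_cases hib : i = b
        · subst hib; rw [flip_outDeg_b o i F hF]; omega
        · rw [flip_outDeg_other o b F i (fun h => hi' (hFA i h)) hib]
      · exact ⟨b, by simpa using hb, by rw [flip_outDeg_b o b F hF]; omega⟩
    omega
  refine ⟨o, ?_, ?_⟩
  · intro u v huv
    have := hbip u v huv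
    by_cases hu : A u
    · exact key u v hu (this.1 hu) huv
    · exact (key v u (by tauto) hu huv.symm).symm
  · intro u
    by_cases hu : A u
    · have := ho.high u hu; omega
    · exact ho.le u hu

end

theorem stmt5 {V : Type*} [Fintype V] (G : SimpleGraph V) (hbip : G.Colorable 2) :
    ∃ o : GOrientation G, o.IsProper ∧ ∀ u, o.outDeg u ≤ ⌈mad G / 2⌉₊ + 3 := by
  classical
  obtain ⟨c⟩ := hbip
  obtain ⟨o, ho⟩ := hakimi G
  have hb : ∀ u v, G.Adj u v → (c u = 0 ↔ ¬ c v = 0) := by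
    intro u v h
    have := c.valid h
    omega
  exact inv_final (fun v => c v = 0) _ hb (inv_init (fun v => c v = 0) _ hb o ho)
end

section
/- Every finite simple bipartite planar graph G satisfies χ⃗(G) ≤ 5. -/
open SimpleGraph Finset

namespace PO
open Classical

variable {V : Type*}

/-- Connectivity of a vertex set, through chains inside the set. -/
def Conn (H : SimpleGraph V) (B : Set V) : Prop :=
  ∀ x ∈ B, ∀ y ∈ B, Relation.ReflTransGen (fun x y => H.Adj x y ∧ x ∈ B ∧ y ∈ B) x y

/-- A model of a `K_{3,3}` minor. -/
def K33 (H : SimpleGraph V) : Prop :=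
  ∃ B : Fin 3 ⊕ Fin 3 → Set V, (∀ w, Conn H (B w)) ∧
    (∀ w₁ w₂, w₁ ≠ w₂ → Disjoint (B w₁) (B w₂)) ∧
    (∀ i j, ∃ u ∈ B (Sum.inl i), ∃ v ∈ B (Sum.inr j), H.Adj u v)

lemma K33.nonempty_out {H : SimpleGraph V} {B : Fin 3 ⊕ Fin 3 → Set V}
    (h : ∀ i j, ∃ u ∈ B (Sum.inl i), ∃ v ∈ B (Sum.inr j), H.Adj u v) (w) :
    ∃ x ∈ B w, ∃ y, H.Adj x y := by
  rcases w with i | j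
  · obtain ⟨u, hu, v, hv, h⟩ := h i 0
    exact ⟨u, hu, v, h⟩
  · obtain ⟨u, hu, v, hv, h⟩ := h 0 j
    exact ⟨v, hv, u, h.symm⟩

lemma K33.hasMinor {H : SimpleGraph V} (h : K33 H) :
    HasMinor H (completeBipartiteGraph (Fin 3) (Fin 3)) := by
  obtain ⟨B, hc, hd, ha⟩ := h
  have hne : ∀ w, (B w).Nonempty := fun w => by
    obtain ⟨x, hx, -⟩ := K33.nonempty_out ha w
    exact ⟨x, hx⟩
  refine ⟨B, hne, ?_, hd, ?_⟩
  · intro w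
    have : Nonempty (B w) := (hne w).to_subtype
    refine SimpleGraph.Connected.mk ?_
    rintro ⟨x, hx⟩ ⟨y, hy⟩
    have key : ∀ y, Relation.ReflTransGen (fun x y => H.Adj x y ∧ x ∈ B w ∧ y ∈ B w) x y →
        ∀ hy : y ∈ B w, (H.induce (B w)).Reachable ⟨x, hx⟩ ⟨y, hy⟩ := by
      intro y hxy
      induction hxy with
      | refl => intro hy; exact SimpleGraph.Reachable.refl _
      | tail _ h2 ih =>
        intro hz
        refine (ih h2.2.1).trans (SimpleGraph.Adj.reachable ?_)
        exact h2.1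
    exact key y (hc w x hx y hy) hy
  · rintro (i | i) (j | j) hij
    · simp at hij
    · exact ha i j
    · obtain ⟨u, hu, v, hv, h⟩ := ha j i
      exact ⟨v, hv, u, hu, h.symm⟩
    · simp at hij

lemma K33.mono {H K : SimpleGraph V} (hle : ∀ x y, H.Adj x y → K.Adj x y) (h : K33 H) : K33 K := by
  obtain ⟨B, hc, hd, ha⟩ := h
  refine ⟨B, ?_, hd, ?_⟩
  · intro w x hx y hy
    refine Relation.ReflTransGen.mono ?_ _ _ (hc w x hx y hy)
    intro a b hab
    exact ⟨hle _ _ hab.1, hab.2⟩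
  · intro i j
    obtain ⟨u, hu, v, hv, h⟩ := ha i j
    exact ⟨u, hu, v, hv, hle _ _ h⟩

/-- Restriction to a vertex set. -/
def rst (H : SimpleGraph V) (T : Finset V) : SimpleGraph V where
  Adj x y := H.Adj x y ∧ x ∈ T ∧ y ∈ T
  symm := ⟨fun _ _ h => ⟨h.1.symm, h.2.2, h.2.1⟩⟩
  loopless := ⟨fun x h => H.loopless.irrefl x h.1⟩

/-- Merge `w` into `u`, deleting `v`. -/
def mrg (H : SimpleGraph V) (u v w : V) : SimpleGraph V where
  Adj x y := x ≠ y ∧ x ≠ v ∧ x ≠ w ∧ y ≠ v ∧ y ≠ w ∧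
    (H.Adj x y ∨ (x = u ∧ H.Adj w y) ∨ (y = u ∧ H.Adj w x))
  symm := ⟨fun _ _ h => by
    obtain ⟨h1, h2, h3, h4, h5, h6⟩ := h
    refine ⟨h1.symm, h4, h5, h2, h3, ?_⟩
    rcases h6 with h | h | h
    · exact Or.inl h.symm
    · exact Or.inr (Or.inr h)
    · exact Or.inr (Or.inl h)⟩
  loopless := ⟨fun x h => h.1 rfl⟩

lemma K33.of_mrg {H : SimpleGraph V} {u v w : V} (huv : H.Adj u v) (hwv : H.Adj w v) (huw : u ≠ w)
    (h : K33 (mrg H u v w)) : K33 H := by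
  obtain ⟨B, hc, hd, ha⟩ := h
  let C : Fin 3 ⊕ Fin 3 → Set V := fun i =>
    {x | (x ∈ B i ∧ x ≠ v ∧ x ≠ w) ∨ (u ∈ B i ∧ (x = v ∨ x = w))}
  have huv' : u ≠ v := huv.ne
  have hsub : ∀ i x, x ∈ B i → x ≠ v → x ≠ w → x ∈ C i := fun i x h1 h2 h3 => Or.inl ⟨h1, h2, h3⟩
  have hvC : ∀ i, u ∈ B i → v ∈ C i := fun i h => Or.inr ⟨h, Or.inl rfl⟩
  have hwC : ∀ i, u ∈ B i → w ∈ C i := fun i h => Or.inr ⟨h, Or.inr rfl⟩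
  have huC : ∀ i, u ∈ B i → u ∈ C i := fun i h => Or.inl ⟨h, huv', huw⟩
  have st1 : ∀ i a b, a ∈ C i → b ∈ C i → H.Adj a b →
      Relation.ReflTransGen (fun x y => H.Adj x y ∧ x ∈ C i ∧ y ∈ C i) a b :=
    fun i a b h1 h2 h3 => Relation.ReflTransGen.single ⟨h3, h1, h2⟩
  have uw : ∀ i, u ∈ B i →
      Relation.ReflTransGen (fun x y => H.Adj x y ∧ x ∈ C i ∧ y ∈ C i) u w := fun i h =>
    (st1 i u v (huC i h) (hvC i h) huv).trans (st1 i v w (hvC i h) (hwC i h) hwv.symm)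
  have wu : ∀ i, u ∈ B i →
      Relation.ReflTransGen (fun x y => H.Adj x y ∧ x ∈ C i ∧ y ∈ C i) w u := fun i h =>
    (st1 i w v (hwC i h) (hvC i h) hwv).trans (st1 i v u (hvC i h) (huC i h) huv.symm)
  have step : ∀ i a b, a ∈ B i → b ∈ B i → (mrg H u v w).Adj a b →
      Relation.ReflTransGen (fun x y => H.Adj x y ∧ x ∈ C i ∧ y ∈ C i) a b := by
    rintro i a b hai hbi ⟨h1, h2, h3, h4, h5, h6⟩
    have haC := hsub i a hai h2 h3
    have hbC := hsub i b hbi h4 h5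
    rcases h6 with h | ⟨rfl, h⟩ | ⟨rfl, h⟩
    · exact st1 i a b haC hbC h
    · exact (uw i hai).trans (st1 i w b (hwC i hai) hbC h)
    · exact (st1 i a w haC (hwC i hbi) h.symm).trans (wu i hbi)
  have path : ∀ i a b, Relation.ReflTransGen
      (fun x y => (mrg H u v w).Adj x y ∧ x ∈ B i ∧ y ∈ B i) a b →
      Relation.ReflTransGen (fun x y => H.Adj x y ∧ x ∈ C i ∧ y ∈ C i) a b := by
    intro i a b hab
    induction hab with
    | refl => exact Relation.ReflTransGen.refl
    | tail _ h2 ih => exact ih.trans (step i _ _ h2.2.1 h2.2.2 h2.1)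
  refine ⟨C, ?_, ?_, ?_⟩
  · intro i
    have toB : ∀ x ∈ C i, ∃ y ∈ B i,
        Relation.ReflTransGen (fun x y => H.Adj x y ∧ x ∈ C i ∧ y ∈ C i) x y ∧
        Relation.ReflTransGen (fun x y => H.Adj x y ∧ x ∈ C i ∧ y ∈ C i) y x := by
      rintro x (hx | ⟨hu, rfl | rfl⟩)
      · exact ⟨x, hx.1, .refl, .refl⟩
      · exact ⟨u, hu, st1 i _ _ (hvC i hu) (huC i hu) huv.symm, st1 i _ _ (huC i hu) (hvC i hu) huv⟩
      · exact ⟨u, hu, wu i hu, uw i hu⟩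
    intro x hx y hy
    obtain ⟨x', hx', h1, -⟩ := toB x hx
    obtain ⟨y', hy', -, h2⟩ := toB y hy
    exact h1.trans ((path i x' y' (hc i x' hx' y' hy')).trans h2)
  · intro i j hij
    have := hd i j hij
    rw [Set.disjoint_left] at this ⊢
    rintro x (hx | hx) (hy | hy)
    · exact this hx.1 hy.1
    · rcases hy.2 with h | h
      · exact hx.2.1 h
      · exact hx.2.2 h
    · rcases hx.2 with h | h
      · exact hy.2.1 h
      · exact hy.2.2 h
    · exact this hx.1 hy.1
  · intro i j
    obtain ⟨a, hai, b, hbj, h1, h2, h3, h4, h5, h6⟩ := ha i j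
    have haC := hsub _ a hai h2 h3
    have hbC := hsub _ b hbj h4 h5
    rcases h6 with h | ⟨rfl, h⟩ | ⟨rfl, h⟩
    · exact ⟨a, haC, b, hbC, h⟩
    · exact ⟨w, hwC _ hai, b, hbC, h⟩
    · exact ⟨a, haC, w, hwC _ hbj, h.symm⟩

/-- The explicit `K_{3,3}` minor: two vertices with three common neighbours and a set. -/
lemma K33.build {H : SimpleGraph V} {u w v p q : V} {Y : Set V} (huw : u ≠ w)
    (hvp : v ≠ p) (hvq : v ≠ q) (hpq : p ≠ q)
    (h1 : H.Adj u v) (h2 : H.Adj u p) (h3 : H.Adj u q)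
    (h4 : H.Adj w v) (h5 : H.Adj w p) (h6 : H.Adj w q)
    (hY : Conn H Y) (hu : u ∉ Y) (hw : w ∉ Y) (hv : v ∉ Y) (hp : p ∉ Y) (hq : q ∉ Y)
    (av : ∃ y ∈ Y, H.Adj y v) (ap : ∃ y ∈ Y, H.Adj y p) (aq : ∃ y ∈ Y, H.Adj y q) : K33 H := by
  have sing : ∀ x, Conn H {x} := by
    rintro x a rfl b rfl
    exact Relation.ReflTransGen.refl
  have n1 := h1.ne
  have n2 := h2.ne
  have n3 := h3.ne
  have n4 := h4.ne
  have n5 := h5.ne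
  have n6 := h6.ne
  refine ⟨Sum.elim ![{u}, {w}, Y] ![{v}, {p}, {q}], ?_, ?_, ?_⟩
  · rintro (i | i) <;> fin_cases i <;> simp [sing, hY]
  · rintro (i | i) (j | j) hij <;> fin_cases i <;> fin_cases j <;>
      simp_all [Ne.symm, eq_comm]
  · intro i j
    fin_cases i <;> fin_cases j <;> simpa

variable [Fintype V]

/-- Ordered adjacent pairs. -/
noncomputable def prs (H : SimpleGraph V) : Finset (V × V) :=
  Finset.univ.filter fun p => H.Adj p.1 p.2

noncomputable def nbh (H : SimpleGraph V) (v : V) : Finset V :=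
  Finset.univ.filter fun y => H.Adj v y

@[simp] lemma mem_prs {H : SimpleGraph V} {p : V × V} : p ∈ prs H ↔ H.Adj p.1 p.2 := by
  simp [prs]

@[simp] lemma mem_nbh {H : SimpleGraph V} {v y : V} : y ∈ nbh H v ↔ H.Adj v y := by
  simp [nbh]

lemma prs_small (col : V → Bool) (S : Finset V) (H : SimpleGraph V)
    (hS : ∀ x y, H.Adj x y → x ∈ S) (hb : ∀ x y, H.Adj x y → col x ≠ col y)
    (h3 : 3 ≤ S.card) (h4 : S.card ≤ 4) : (prs H).card + 8 ≤ 4 * S.card := by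
  set A := S.filter (fun x => col x = true)
  set B := S.filter (fun x => ¬ col x = true)
  have hAB : A.card + B.card = S.card := Finset.card_filter_add_card_filter_not _
  have hsub : prs H ⊆ (A ×ˢ B) ∪ (B ×ˢ A) := by
    rintro ⟨x, y⟩ h
    rw [mem_prs] at h
    have h1 := hS _ _ h
    have h2 := hS _ _ h.symm
    have h3 := hb _ _ h
    simp only [A, B, Finset.mem_union, Finset.mem_product, Finset.mem_filter]
    simp only at h1 h2 h3
    cases hx : col x <;> cases hy : col y <;> simp_all
  have h := (Finset.card_le_card hsub).trans (Finset.card_union_le _ _)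
  rw [Finset.card_product, Finset.card_product] at h
  generalize A.card = a at *
  generalize B.card = b at *
  have ha : a ≤ 4 := by omega
  have hb : b ≤ 4 := by omega
  interval_cases a <;> interval_cases b <;> omega

lemma prs_eq_sum (H : SimpleGraph V) (S : Finset V) (hS : ∀ x y, H.Adj x y → x ∈ S) :
    (prs H).card = ∑ v ∈ S, (nbh H v).card := by
  rw [Finset.card_eq_sum_card_fiberwise (f := Prod.fst) (t := S)]
  · refine Finset.sum_congr rfl fun v _ => ?_
    refine Finset.card_bij (fun p _ => p.2) ?_ ?_ ?_
    · rintro ⟨x, y⟩ h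
      simp at h ⊢
      rw [← h.2]; exact h.1
    · rintro ⟨x, y⟩ h ⟨x', y'⟩ h' e
      simp at h h' e ⊢
      exact ⟨h.2.trans h'.2.symm, e⟩
    · intro y hy
      exact ⟨(v, y), by simpa using hy, rfl⟩
  · rintro ⟨x, y⟩ h
    exact hS x y (by simpa using h)

lemma prs_rst_del (H : SimpleGraph V) (S : Finset V) (hS : ∀ x y, H.Adj x y → x ∈ S) (v : V) :
    (prs H).card ≤ (prs (rst H (S.erase v))).card + 2 * (nbh H v).card := by
  have hsub : prs H ⊆ prs (rst H (S.erase v)) ∪ (({v} ×ˢ nbh H v) ∪ (nbh H v ×ˢ {v})) := by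
    rintro ⟨x, y⟩ h
    rw [mem_prs] at h
    have h1 := hS _ _ h
    have h2 := hS _ _ h.symm
    have h3 := h.symm
    simp only [Finset.mem_union, Finset.mem_product, Finset.mem_singleton, mem_prs, mem_nbh, rst,
      Finset.mem_erase]
    simp only at h h1 h2 h3
    by_cases hx : x = v
    · subst hx; simp [h]
    · by_cases hy : y = v
      · subst hy; simp [h3]
      · simp [*]
  have h := Finset.card_le_card hsub
  have h1 := Finset.card_union_le (prs (rst H (S.erase v))) (({v} ×ˢ nbh H v) ∪ (nbh H v ×ˢ {v}))
  have h2 := Finset.card_union_le ({v} ×ˢ nbh H v) (nbh H v ×ˢ {v})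
  rw [Finset.card_product, Finset.card_product, Finset.card_singleton] at h2
  omega

lemma prs_cut (H : SimpleGraph V) (S T : Finset V) (hS : ∀ x y, H.Adj x y → x ∈ S)
    {u w p q : V} (huw : u ≠ w) (hpq : p ≠ q)
    (h1 : H.Adj u p) (h2 : H.Adj u q) (h3 : H.Adj w p) (h4 : H.Adj w q)
    (hcut : ∀ x y, H.Adj x y → x ∈ T → y ∈ T ∨ y ∈ ({u, w, p, q} : Finset V))
    (hT : ∀ x ∈ T, x ∉ ({u, w, p, q} : Finset V)) :
    (prs H).card + 8 ≤ (prs (rst H (T ∪ {u, w, p, q}))).card + (prs (rst H (S \ T))).card := by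
  set C : Finset V := {u, w, p, q} with hC
  have e1 : prs (rst H (T ∪ C)) ∪ prs (rst H (S \ T)) = prs H := by
    ext ⟨x, y⟩
    simp only [Finset.mem_union, mem_prs, rst, Finset.mem_sdiff]
    constructor
    · rintro (h | h) <;> exact h.1
    · intro h
      have a1 := hcut x y h
      have a2 := hcut y x h.symm
      have a3 := hS _ _ h
      have a4 := hS _ _ h.symm
      have a5 := hT x
      have a6 := hT y
      tauto
  have e2 : (({u, w} : Finset V) ×ˢ ({p, q} : Finset V)) ∪ (({p, q} : Finset V) ×ˢ ({u, w} : Finset V)) ⊆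
      prs (rst H (T ∪ C)) ∩ prs (rst H (S \ T)) := by
    have hu : u ∈ C := by simp [hC]
    have hw : w ∈ C := by simp [hC]
    have hp : p ∈ C := by simp [hC]
    have hq : q ∈ C := by simp [hC]
    have nT : ∀ x ∈ C, x ∉ T := fun x hx hx' => hT x hx' hx
    have key : ∀ x y, x ∈ C → y ∈ C → H.Adj x y →
        (x, y) ∈ prs (rst H (T ∪ C)) ∩ prs (rst H (S \ T)) := by
      intro x y hx hy h
      simp only [Finset.mem_inter, Finset.mem_union, mem_prs, rst, Finset.mem_sdiff]
      exact ⟨⟨h, Or.inr hx, Or.inr hy⟩, h, ⟨hS _ _ h, nT _ hx⟩, ⟨hS _ _ h.symm, nT _ hy⟩⟩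
    rintro ⟨x, y⟩ h
    simp only [Finset.mem_union, Finset.mem_product, Finset.mem_insert, Finset.mem_singleton] at h
    rcases h with ⟨rfl | rfl, rfl | rfl⟩ | ⟨rfl | rfl, rfl | rfl⟩ <;> apply key <;>
      first | assumption | (apply SimpleGraph.Adj.symm; assumption)
  have e3 : ((({u, w} : Finset V) ×ˢ ({p, q} : Finset V)) ∪
      (({p, q} : Finset V) ×ˢ ({u, w} : Finset V))).card = 8 := by
    rw [Finset.card_union_of_disjoint, Finset.card_product, Finset.card_product,
      Finset.card_pair huw, Finset.card_pair hpq]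
    rw [Finset.disjoint_left]
    rintro ⟨x, y⟩ h h'
    have n1 := h1.ne
    have n2 := h2.ne
    have n3 := h3.ne
    have n4 := h4.ne
    simp only [Finset.mem_product, Finset.mem_insert, Finset.mem_singleton] at h h'
    grind
  have e4 := Finset.card_le_card e2
  have e5 := Finset.card_union_add_card_inter (prs (rst H (T ∪ C))) (prs (rst H (S \ T)))
  rw [e1] at e5
  omega

lemma prs_mrg (H : SimpleGraph V) {u v w : V} (huw : u ≠ w) (huv : u ≠ v) (hnuw : ¬ H.Adj u w)
    (hv : (nbh H v).card = 3) (c : V)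
    (hc : ∀ y, H.Adj u y → H.Adj w y → y = v ∨ y = c) :
    (prs H).card ≤ (prs (mrg H u v w)).card + 8 := by
  set bad : Finset (V × V) := (({v} ×ˢ nbh H v) ∪ (nbh H v ×ˢ {v})) ∪ {(w, c), (c, w)} with hbad
  have hb : bad.card ≤ 8 := by
    have h1 := Finset.card_union_le (({v} ×ˢ nbh H v) ∪ (nbh H v ×ˢ {v})) {(w, c), (c, w)}
    have h2 := Finset.card_union_le ({v} ×ˢ nbh H v) (nbh H v ×ˢ {v})
    have h3 : ({(w, c), (c, w)} : Finset (V × V)).card ≤ 2 := Finset.card_le_two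
    rw [Finset.card_product, Finset.card_product, Finset.card_singleton] at h2
    rw [hbad]
    omega
  clear_value bad
  have hinj : (prs H \ bad).card ≤ (prs (mrg H u v w)).card := by
    refine Finset.card_le_card_of_injOn
      (fun p => (if p.1 = w then u else p.1, if p.2 = w then u else p.2)) ?_ ?_
    · rintro ⟨x, y⟩ h
      have hs : ∀ a b, H.Adj a b → H.Adj b a := fun a b h => h.symm
      have hi : ∀ a, ¬ H.Adj a a := fun a => H.loopless.irrefl a
      simp only [hbad, Finset.coe_sdiff, Set.mem_sdiff, Finset.mem_coe, mem_prs, Finset.mem_union,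
        Finset.mem_product, Finset.mem_singleton, mem_nbh, Finset.mem_insert, Prod.mk.injEq] at h
      simp only [Finset.mem_coe, mem_prs, mrg]
      clear hb hbad hv
      grind
    · rintro ⟨x, y⟩ h ⟨x', y'⟩ h' e
      have hs : ∀ a b, H.Adj a b → H.Adj b a := fun a b h => h.symm
      have hi : ∀ a, ¬ H.Adj a a := fun a => H.loopless.irrefl a
      simp only [hbad, Finset.coe_sdiff, Set.mem_sdiff, Finset.mem_coe, mem_prs, Finset.mem_union,
        Finset.mem_product, Finset.mem_singleton, mem_nbh, Finset.mem_insert, Prod.mk.injEq] at h h' e ⊢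
      grind
  have h1 := Finset.le_card_sdiff bad (prs H)
  omega

lemma prs_mrg_le (H : SimpleGraph V) (u v w : V) :
    (prs (mrg H u v w)).card ≤ (prs H).card := by
  refine le_trans (Finset.card_le_card ?_) (Finset.card_image_le (s := prs H)
    (f := fun p => (if p.1 = w then u else p.1, if p.2 = w then u else p.2)))
  rintro ⟨x, y⟩ h
  simp only [mem_prs, mrg] at h
  obtain ⟨h1, h2, h3, h4, h5, h6⟩ := h
  rw [Finset.mem_image]
  rcases h6 with h | ⟨rfl, h⟩ | ⟨rfl, h⟩
  · exact ⟨(x, y), by simpa using h, by simp [h3, h5]⟩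
  · exact ⟨(w, y), by simpa using h, by simp [h5]⟩
  · exact ⟨(x, w), by simpa using h.symm, by simp [h3]⟩

lemma bool3 : ∀ a b c : Bool, a ≠ b → a ≠ c → b = c := by decide

lemma prs_delEdge (H : SimpleGraph V) {a b : V} (h : H.Adj a b) :
    (prs (H.deleteEdges {s(a, b)})).card < (prs H).card ∧
    (prs H).card ≤ (prs (H.deleteEdges {s(a, b)})).card + 2 := by
  constructor
  · apply Finset.card_lt_card
    rw [Finset.ssubset_iff_of_subset]
    · exact ⟨(a, b), by simpa using h, by simp⟩
    · intro p
      simp only [mem_prs, SimpleGraph.deleteEdges_adj]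
      exact fun h => h.1
  · have hsub : prs H ⊆ prs (H.deleteEdges {s(a, b)}) ∪ {(a, b), (b, a)} := by
      rintro ⟨x, y⟩ h
      simp only [mem_prs, SimpleGraph.deleteEdges_adj, Finset.mem_union, Finset.mem_insert,
        Finset.mem_singleton, Prod.mk.injEq, Set.mem_singleton_iff, Sym2.eq_iff] at h ⊢
      tauto
    have h1 := (Finset.card_le_card hsub).trans (Finset.card_union_le _ _)
    have h3 : ({(a, b), (b, a)} : Finset (V × V)).card ≤ 2 := Finset.card_le_two
    omega

set_option maxHeartbeats 1000000 in
/-- The density bound. -/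
lemma dens (col : V → Bool) : ∀ (n : ℕ) (S : Finset V) (H : SimpleGraph V),
    S.card + (prs H).card ≤ n → (∀ x y, H.Adj x y → x ∈ S) →
    (∀ x y, H.Adj x y → col x ≠ col y) → ¬ K33 H → 3 ≤ S.card →
    (prs H).card + 8 ≤ 4 * S.card := by
  intro n
  induction n with
  | zero => intro S H h _ _ _ h3; omega
  | succ n ih =>
  intro S H hn hS hb hK h3
  by_cases h4 : S.card ≤ 4
  · exact prs_small col S H hS hb h3 h4
  by_contra hlt
  have hD : (prs H).card < 4 * S.card := by
    by_contra hge
    have : (prs H).Nonempty := by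
      rw [← Finset.card_pos]; omega
    obtain ⟨⟨a, b⟩, hab⟩ := this
    have hab' : H.Adj a b := by simpa using hab
    obtain ⟨g1, g2⟩ := prs_delEdge H hab'
    have hle : ∀ x y, (H.deleteEdges {s(a, b)}).Adj x y → H.Adj x y := fun x y h => by
      rw [SimpleGraph.deleteEdges_adj] at h
      exact h.1
    have := ih S (H.deleteEdges {s(a, b)}) (by omega) (fun x y h => hS x y (hle x y h))
      (fun x y h => hb x y (hle x y h)) (fun h => hK (h.mono hle)) h3
    omega
  have ihr : ∀ T : Finset V, T.card < S.card → 3 ≤ T.card →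
      (prs (rst H T)).card + 8 ≤ 4 * T.card := by
    intro T hT1 hT2
    refine ih T (rst H T) ?_ (fun x y h => h.2.1) (fun x y h => hb x y h.1)
      (fun h => hK (K33.mono (fun x y (h' : (rst H T).Adj x y) => h'.1) h)) hT2
    have : (prs (rst H T)).card ≤ (prs H).card := Finset.card_le_card (by
      intro p; simp only [mem_prs]; exact fun h => h.1)
    omega
  have hdeg : ∀ v ∈ S, 3 ≤ (nbh H v).card := by
    intro v hv
    by_contra hlt3
    have h1 := prs_rst_del H S hS v
    have h2 := Finset.card_erase_of_mem hv
    have h3 := ihr (S.erase v) (by omega) (by omega)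
    omega
  obtain ⟨v, hvS, hv3⟩ : ∃ v ∈ S, (nbh H v).card = 3 := by
    by_contra hno
    push Not at hno
    have h1 := prs_eq_sum H S hS
    have h2 : ∑ v ∈ S, 4 ≤ ∑ v ∈ S, (nbh H v).card := by
      refine Finset.sum_le_sum fun v hv => ?_
      have := hdeg v hv
      have := hno v hv
      omega
    rw [Finset.sum_const, smul_eq_mul] at h2
    omega
  have ncut : ∀ (T : Finset V) (u w p q : V), u ≠ w → p ≠ q → H.Adj u p → H.Adj u q →
      H.Adj w p → H.Adj w q → T.Nonempty → T ⊆ S → (∀ x ∈ T, x ∉ ({u, w, p, q} : Finset V)) →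
      (∃ z ∈ S, z ∉ T ∧ z ∉ ({u, w, p, q} : Finset V)) →
      ∃ x y, H.Adj x y ∧ x ∈ T ∧ y ∉ T ∧ y ∉ ({u, w, p, q} : Finset V) := by
    intro T u w p q huw hpq h1 h2 h3 h4 hTn hTS hTC ⟨z, hzS, hzT, hzC⟩
    by_contra hno
    push Not at hno
    have hcut := prs_cut H S T hS huw hpq h1 h2 h3 h4 (fun x y h hx => by
      by_cases hy : y ∈ T
      · exact Or.inl hy
      · exact Or.inr (hno x y h hx hy)) hTC
    have hCcard : ({u, w, p, q} : Finset V).card = 4 := by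
      have := h1.ne
      have := h2.ne
      have := h3.ne
      have := h4.ne
      rw [Finset.card_insert_of_notMem, Finset.card_insert_of_notMem, Finset.card_pair hpq] <;>
        simp [*]
    have hCS : ({u, w, p, q} : Finset V) ⊆ S := by
      intro x hx
      simp only [Finset.mem_insert, Finset.mem_singleton] at hx
      rcases hx with rfl | rfl | rfl | rfl
      · exact hS _ _ h1
      · exact hS _ _ h3
      · exact hS _ _ h1.symm
      · exact hS _ _ h2.symm
    generalize ({u, w, p, q} : Finset V) = C at *
    have c1 : (T ∪ C).card = T.card + C.card := by
      apply Finset.card_union_of_disjoint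
      rw [Finset.disjoint_left]; exact hTC
    have c2 : (S \ T).card + T.card = S.card := Finset.card_sdiff_add_card_eq_card hTS
    have c3 : 0 < T.card := hTn.card_pos
    have c4 : (T ∪ C).card < S.card := by
      apply Finset.card_lt_card
      rw [Finset.ssubset_iff_of_subset (Finset.union_subset hTS hCS)]
      exact ⟨z, hzS, by simp [hzT, hzC]⟩
    have i1 := ihr (T ∪ C) c4 (by omega)
    have i2 := ihr (S \ T) (by omega) (by omega)
    omega
  obtain ⟨u, w, x, huw, hux, hwx, hN⟩ := Finset.card_eq_three.1 hv3
  have hvu : H.Adj v u := by rw [← mem_nbh, hN]; simp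
  have hvw : H.Adj v w := by rw [← mem_nbh, hN]; simp
  have hvx : H.Adj v x := by rw [← mem_nbh, hN]; simp
  have cu := hb _ _ hvu
  have cw := hb _ _ hvw
  have cx := hb _ _ hvx
  by_cases hcom : ∃ p q, p ≠ q ∧ p ≠ v ∧ q ≠ v ∧ H.Adj u p ∧ H.Adj w p ∧ H.Adj u q ∧ H.Adj w q
  · obtain ⟨p, q, hpq, hpv, hqv, hup, hwp, huq, hwq⟩ := hcom
    apply hK
    let Z : Set V := {z | z ∈ S ∧ z ≠ u ∧ z ≠ w ∧ z ≠ v ∧ z ≠ p ∧ z ≠ q}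
    let R : V → V → Prop := fun a b => H.Adj a b ∧ a ∈ Z ∧ b ∈ Z
    let Y : Set V := {y | Relation.ReflTransGen R x y}
    have cp := hb _ _ hup
    have cq := hb _ _ huq
    have hxp : x ≠ p := by
      rintro rfl
      exact cp (bool3 _ _ _ cu cx)
    have hxq : x ≠ q := by
      rintro rfl
      exact cq (bool3 _ _ _ cu cx)
    have hxZ : x ∈ Z := ⟨hS _ _ hvx.symm, hux.symm, hwx.symm, hvx.ne', hxp, hxq⟩
    have hYZ : ∀ y ∈ Y, y ∈ Z := by
      intro y hy
      rcases Relation.ReflTransGen.cases_tail hy with rfl | ⟨c, -, hc⟩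
      · exact hxZ
      · exact hc.2.2
    have hxY : x ∈ Y := Relation.ReflTransGen.refl
    have hYcl : ∀ y ∈ Y, ∀ z ∈ Z, H.Adj y z → z ∈ Y := fun y hy z hz h =>
      Relation.ReflTransGen.tail hy ⟨h, hYZ y hy, hz⟩
    have hYconn : Conn H Y := by
      have fwd : ∀ y, Relation.ReflTransGen R x y →
          Relation.ReflTransGen (fun a b => H.Adj a b ∧ a ∈ Y ∧ b ∈ Y) x y ∧
          Relation.ReflTransGen (fun a b => H.Adj a b ∧ a ∈ Y ∧ b ∈ Y) y x := by
        intro y hy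
        induction hy with
        | refl => exact ⟨.refl, .refl⟩
        | tail h1 h2 ih =>
          exact ⟨ih.1.tail ⟨h2.1, h1, h1.tail h2⟩,
            (Relation.ReflTransGen.single ⟨h2.1.symm, h1.tail h2, h1⟩).trans ih.2⟩
      intro a ha b hb
      exact (fwd a ha).2.trans (fwd b hb).1
    let T : Finset V := Finset.univ.filter (fun y => y ∈ Y)
    have hT : ∀ y, y ∈ T ↔ y ∈ Y := fun y => by simp [T]
    have adjp : ∀ p q, p ≠ q → p ≠ v → q ≠ v → H.Adj u p → H.Adj w p → H.Adj u q → H.Adj w q →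
        (∀ z ∈ Z, z ≠ p ∧ z ≠ q) → (∀ z ∈ S, z ≠ u → z ≠ w → z ≠ v → z ≠ p → z ≠ q → z ∈ Z) →
        ∃ y ∈ Y, H.Adj y p := by
      intro p q hpq hpv hqv hup hwp huq hwq hZ hZ'
      obtain ⟨a, b, hab, haT, hbT, hbC⟩ := ncut T u w v q huw hqv.symm hvu.symm huq hvw.symm hwq
        ⟨x, (hT x).2 hxY⟩ (fun y hy => (hYZ y ((hT y).1 hy)).1)
        (fun y hy => by
          have h1 := hYZ y ((hT y).1 hy)
          have h2 := hZ y h1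
          simp [h1.2.1, h1.2.2.1, h1.2.2.2.1, h2.2])
        ⟨p, hS _ _ hup.symm, fun hp => (hZ p (hYZ p ((hT p).1 hp))).1 rfl, by
          simp [hup.ne', hwp.ne', hpv, hpq]⟩
      rw [hT] at haT hbT
      simp only [Finset.mem_insert, Finset.mem_singleton, not_or] at hbC
      by_cases hbp : b = p
      · exact ⟨a, haT, hbp ▸ hab⟩
      · exact absurd (hYcl a haT b (hZ' b (hS _ _ hab.symm) hbC.1 hbC.2.1 hbC.2.2.1 hbp hbC.2.2.2)
          hab) hbT
    refine K33.build (Y := Y) huw hpv.symm hqv.symm hpq hvu.symm hup huq hvw.symm hwp hwq hYconn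
      (fun h => (hYZ _ h).2.1 rfl) (fun h => (hYZ _ h).2.2.1 rfl) (fun h => (hYZ _ h).2.2.2.1 rfl)
      (fun h => (hYZ _ h).2.2.2.2.1 rfl) (fun h => (hYZ _ h).2.2.2.2.2 rfl) ⟨x, hxY, hvx.symm⟩ ?_ ?_
    · exact adjp p q hpq hpv hqv hup hwp huq hwq (fun z hz => hz.2.2.2.2)
        (fun z h1 h2 h3 h4 h5 h6 => ⟨h1, h2, h3, h4, h5, h6⟩)
    · exact adjp q p hpq.symm hqv hpv huq hwq hup hwp (fun z hz => hz.2.2.2.2.symm)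
        (fun z h1 h2 h3 h4 h5 h6 => ⟨h1, h2, h3, h4, h6, h5⟩)
  · have hcu : col u = col w := bool3 _ _ _ cu cw
    obtain ⟨c, hc⟩ : ∃ c, ∀ y, H.Adj u y → H.Adj w y → y = v ∨ y = c := by
      by_cases hex : ∃ c, c ≠ v ∧ H.Adj u c ∧ H.Adj w c
      · obtain ⟨c, hcv, h1, h2⟩ := hex
        refine ⟨c, fun y h3 h4 => ?_⟩
        by_contra hne
        rw [not_or] at hne
        exact hcom ⟨y, c, hne.2, hne.1, hcv, h3, h4, h1, h2⟩
      · push Not at hex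
        refine ⟨v, fun y h3 h4 => ?_⟩
        by_contra hne
        rw [or_self] at hne
        exact hex y hne h3 h4
    have hm := prs_mrg H huw hvu.ne' (fun h => hb _ _ h hcu) hv3 c hc
    have hcard : ((S.erase v).erase w).card + 2 = S.card := by
      rw [Finset.card_erase_of_mem, Finset.card_erase_of_mem hvS]
      · omega
      · exact Finset.mem_erase.2 ⟨hvw.ne', hS _ _ hvw.symm⟩
    have hle := prs_mrg_le H u v w
    have := ih ((S.erase v).erase w) (mrg H u v w) (by omega) ?_ ?_
      (fun h => hK (K33.of_mrg hvu.symm hvw.symm huw h)) (by omega)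
    · omega
    · rintro a b ⟨h1, h2, h3, h4, h5, h6⟩
      refine Finset.mem_erase.2 ⟨h3, Finset.mem_erase.2 ⟨h2, ?_⟩⟩
      rcases h6 with h | ⟨rfl, h⟩ | ⟨rfl, h⟩
      · exact hS _ _ h
      · exact hS _ _ hvu.symm
      · exact hS _ _ h.symm
    · rintro a b ⟨h1, h2, h3, h4, h5, h6⟩
      rcases h6 with h | ⟨rfl, h⟩ | ⟨rfl, h⟩
      · exact hb _ _ h
      · rw [hcu]; exact hb _ _ h
      · rw [hcu]; exact (hb _ _ h).symm

lemma dens_sub (col : V → Bool) (G : SimpleGraph V) (hb : ∀ x y, G.Adj x y → col x ≠ col y)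
    (hK : ¬ K33 G) (S : Finset V) : (prs (rst G S)).card ≤ 4 * S.card := by
  by_cases h3 : 3 ≤ S.card
  · have := dens col _ S (rst G S) le_rfl (fun x y h => h.2.1) (fun x y h => hb x y h.1)
      (fun h => hK (K33.mono (fun x y (h' : (rst G S).Adj x y) => h'.1) h)) h3
    omega
  · have h1 : prs (rst G S) ⊆ S ×ˢ S := by
      rintro ⟨x, y⟩ h
      rw [mem_prs] at h
      exact Finset.mem_product.2 h.2
    have h2 := Finset.card_le_card h1
    rw [Finset.card_product] at h2
    have : S.card * S.card ≤ 4 * S.card := Nat.mul_le_mul_right _ (by omega)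
    omega

lemma exists_two (col : V → Bool) (G : SimpleGraph V) (hb : ∀ x y, G.Adj x y → col x ≠ col y)
    (hd : ∀ S : Finset V, (prs (rst G S)).card ≤ 4 * S.card) :
    ∃ o : GOrientation G, ∀ u, o.outDeg u ≤ 2 := by
  let I := {p : V × V // G.Adj p.1 p.2 ∧ col p.1 = true}
  let t : I → Finset (V × Fin 2) := fun p => ({p.1.1, p.1.2} : Finset V) ×ˢ Finset.univ
  have hall : ∀ s : Finset I, s.card ≤ (s.biUnion t).card := by
    intro s
    set S : Finset V := s.biUnion (fun p => ({p.1.1, p.1.2} : Finset V)) with hSdef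
    have hS : ∀ p ∈ s, p.1.1 ∈ S ∧ p.1.2 ∈ S := by
      intro p hp
      constructor <;> exact Finset.mem_biUnion.2 ⟨p, hp, by simp⟩
    have h1 : s.biUnion t = S ×ˢ (Finset.univ : Finset (Fin 2)) := by
      ext ⟨x, i⟩
      simp [t, hSdef]
    rw [h1, Finset.card_product]
    have h2 := hd S
    have h3 : s.image (fun p : I => (p.1.1, p.1.2)) ∪ s.image (fun p : I => (p.1.2, p.1.1)) ⊆
        prs (rst G S) := by
      intro q hq
      rcases Finset.mem_union.1 hq with h | h
      · obtain ⟨p, hp, rfl⟩ := Finset.mem_image.1 h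
        rw [mem_prs]
        exact ⟨p.2.1, (hS p hp).1, (hS p hp).2⟩
      · obtain ⟨p, hp, rfl⟩ := Finset.mem_image.1 h
        rw [mem_prs]
        exact ⟨p.2.1.symm, (hS p hp).2, (hS p hp).1⟩
    have h4 := Finset.card_le_card h3
    rw [Finset.card_union_of_disjoint, Finset.card_image_of_injective,
      Finset.card_image_of_injective] at h4
    · simp only [Finset.card_univ, Fintype.card_fin]
      omega
    · rintro ⟨⟨a, b⟩, h⟩ ⟨⟨a', b'⟩, h'⟩ e
      simp only [Prod.mk.injEq] at e
      obtain ⟨rfl, rfl⟩ := e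
      rfl
    · rintro ⟨⟨a, b⟩, h⟩ ⟨⟨a', b'⟩, h'⟩ e
      simp only [Prod.mk.injEq] at e
      obtain ⟨rfl, rfl⟩ := e
      rfl
    · rw [Finset.disjoint_left]
      intro q hq hq'
      obtain ⟨p, hp, rfl⟩ := Finset.mem_image.1 hq
      obtain ⟨p', hp', e⟩ := Finset.mem_image.1 hq'
      simp only [Prod.mk.injEq] at e
      have c1 := hb _ _ p'.2.1
      have c2 := p'.2.2
      have c3 := p.2.2
      rw [← e.1] at c3
      exact c1 (c2.trans c3.symm)
  obtain ⟨f, hfi, hft⟩ := (Finset.all_card_le_biUnion_card_iff_exists_injective t).1 hall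
  have hf1 : ∀ p : I, (f p).1 = p.1.1 ∨ (f p).1 = p.1.2 := by
    intro p
    have := hft p
    simp only [t, Finset.mem_product, Finset.mem_insert, Finset.mem_singleton] at this
    exact this.1
  let D : V → V → Prop := fun x y =>
    ∃ p : I, (p.1 = (x, y) ∧ (f p).1 = x) ∨ (p.1 = (y, x) ∧ (f p).1 = x)
  have hDadj : ∀ x y, D x y → G.Adj x y := by
    rintro x y ⟨⟨⟨a, b⟩, hp⟩, ⟨e, -⟩ | ⟨e, -⟩⟩
    · simp only [Prod.mk.injEq] at e
      obtain ⟨rfl, rfl⟩ := e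
      exact hp.1
    · simp only [Prod.mk.injEq] at e
      obtain ⟨rfl, rfl⟩ := e
      exact hp.1.symm
  have key : ∀ x y, G.Adj x y → col x = true → D x y ∨ D y x := by
    intro x y h hx
    rcases hf1 ⟨(x, y), h, hx⟩ with h1 | h1
    · exact Or.inl ⟨⟨(x, y), h, hx⟩, Or.inl ⟨rfl, h1⟩⟩
    · exact Or.inr ⟨⟨(x, y), h, hx⟩, Or.inr ⟨rfl, h1⟩⟩
  let o : GOrientation G :=
    { dir := fun x y => decide (D x y)
      adj_iff := by
        intro x y
        simp only [decide_eq_true_eq]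
        constructor
        · intro h
          cases hx : col x
          · have : col y = true := by
              have := hb _ _ h
              rw [hx] at this
              cases hy : col y
              · exact absurd hy.symm this
              · rfl
            exact (key y x h.symm this).symm
          · exact key x y h hx
        · rintro (h | h)
          · exact hDadj _ _ h
          · exact (hDadj _ _ h).symm
      not_both := by
        intro x y
        simp only [decide_eq_true_eq]
        rintro ⟨h1, h2⟩
        have hne := (hDadj _ _ h1).ne
        have hcol := hb _ _ (hDadj _ _ h1)
        obtain ⟨⟨⟨a, b⟩, hp⟩, h1⟩ := h1
        obtain ⟨⟨⟨a', b'⟩, hp'⟩, h2⟩ := h2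
        simp only [Prod.mk.injEq] at h1 h2 hp hp'
        rcases h1 with ⟨⟨rfl, rfl⟩, e1⟩ | ⟨⟨rfl, rfl⟩, e1⟩ <;>
        rcases h2 with ⟨⟨rfl, rfl⟩, e2⟩ | ⟨⟨rfl, rfl⟩, e2⟩
        · exact hcol (hp.2.trans hp'.2.symm)
        · exact hne (e1.symm.trans e2)
        · exact hne (e1.symm.trans e2)
        · exact hcol (hp'.2.trans hp.2.symm) }
  refine ⟨o, fun u => ?_⟩
  let P : Finset I := Finset.univ.filter (fun p => (f p).1 = u)
  have hP : P.card ≤ 2 := by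
    have h1 : P.card ≤ (({u} : Finset V) ×ˢ (Finset.univ : Finset (Fin 2))).card := by
      refine Finset.card_le_card_of_injOn f ?_ (fun _ _ _ _ h => hfi h)
      intro p hp
      have hp' : (f p).1 = u := by simpa [P] using hp
      exact Finset.mem_coe.2 (Finset.mem_product.2 ⟨Finset.mem_singleton.2 hp', Finset.mem_univ _⟩)
    simpa using h1
  refine le_trans ?_ hP
  refine le_trans (Finset.card_le_card ?_)
    (Finset.card_image_le (s := P) (f := fun p : I => if p.1.1 = u then p.1.2 else p.1.1))
  intro y hy
  simp only [Finset.mem_filter, Finset.mem_univ, true_and, o, decide_eq_true_eq] at hy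
  have hne := (hDadj _ _ hy).ne'
  obtain ⟨p, ⟨e, h⟩ | ⟨e, h⟩⟩ := hy
  · exact Finset.mem_image.2 ⟨p, by simp [P, h], by simp [e]⟩
  · exact Finset.mem_image.2 ⟨p, by simp [P, h], by simp [e, hne]⟩

section flip
variable {G : SimpleGraph V}

/-- Reverse all edges from `F` to `b`. -/
noncomputable def flp (o : GOrientation G) (b : V) (F : Finset V)
    (hF : ∀ a ∈ F, o.dir a b = true) : GOrientation G where
  dir x y := decide ((o.dir x y = true ∧ ¬ (y = b ∧ x ∈ F)) ∨ (x = b ∧ y ∈ F))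
  adj_iff := by
    intro x y
    have h1 := o.adj_iff x y
    have h2 := hF x
    have h3 := hF y
    simp only [decide_eq_true_eq]
    grind
  not_both := by
    intro x y
    have h1 := o.not_both x y
    have h2 := hF x
    have h3 := hF y
    have h4 := o.not_both b b
    simp only [decide_eq_true_eq]
    grind

lemma flp_dir (o : GOrientation G) (b : V) (F : Finset V) (hF) (x y : V) :
    (flp o b F hF).dir x y = true ↔
      ((o.dir x y = true ∧ ¬ (y = b ∧ x ∈ F)) ∨ (x = b ∧ y ∈ F)) := by
  simp only [flp, decide_eq_true_eq]

lemma flp_out_b (o : GOrientation G) (b : V) (F : Finset V) (hF) :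
    (flp o b F hF).outDeg b = o.outDeg b + F.card := by
  unfold GOrientation.outDeg
  rw [← Finset.card_union_of_disjoint]
  · congr 1
    ext y
    have h3 := hF y
    have h4 := o.not_both b b
    simp only [Finset.mem_filter, Finset.mem_univ, true_and, flp_dir, Finset.mem_union]
    grind
  · rw [Finset.disjoint_left]
    intro y hy hy'
    simp only [Finset.mem_filter, Finset.mem_univ, true_and] at hy
    exact o.not_both _ _ ⟨hy, hF y hy'⟩

lemma flp_out_F (o : GOrientation G) (b : V) (F : Finset V) (hF) (a : V) (ha : a ∈ F) :
    (flp o b F hF).outDeg a + 1 = o.outDeg a := by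
  unfold GOrientation.outDeg
  have : Finset.univ.filter (fun v => (flp o b F hF).dir a v = true) =
      (Finset.univ.filter (fun v => o.dir a v = true)).erase b := by
    ext y
    have h3 := hF a ha
    have h4 := o.not_both b b
    simp only [Finset.mem_filter, Finset.mem_univ, true_and, flp_dir, Finset.mem_erase]
    grind
  rw [this]
  apply Finset.card_erase_add_one
  simp [hF a ha]

lemma flp_out_other (o : GOrientation G) (b : V) (F : Finset V) (hF) (a : V) (ha : a ∉ F)
    (hab : a ≠ b) : (flp o b F hF).outDeg a = o.outDeg a := by
  unfold GOrientation.outDeg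
  congr 1
  ext y
  simp [flp_dir, ha, hab]

end flip

lemma exists_max {α : Type*} (P : α → Prop) (μ : α → ℕ) (N : ℕ) (hb : ∀ a, P a → μ a ≤ N)
    (h : ∃ a, P a) : ∃ a, P a ∧ ∀ b, P b → μ b ≤ μ a := by
  have key : ∀ n a, P a → N - μ a ≤ n → ∃ a, P a ∧ ∀ b, P b → μ b ≤ μ a := by
    intro n
    induction n with
    | zero =>
      intro a ha hn
      exact ⟨a, ha, fun b hb' => by have := hb b hb'; omega⟩
    | succ n ih =>
      intro a ha hn
      by_cases hm : ∀ b, P b → μ b ≤ μ a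
      · exact ⟨a, ha, hm⟩
      · push Not at hm
        obtain ⟨b, hb1, hb2⟩ := hm
        have := hb b hb1
        exact ih b hb1 (by omega)
  obtain ⟨a, ha⟩ := h
  exact key _ a ha le_rfl

lemma select (L : Finset V) (g : V → ℕ) (hg : ∀ a ∈ L, g a ≤ 3) (d : ℕ) (hd : d = 1 ∨ d = 2)
    (a₀ : V) (h0 : a₀ ∈ L) (hga : g a₀ = d) :
    ∃ (t : ℕ) (F : Finset V), d < t ∧ (t = 2 ∨ t = 3 ∨ t = 5) ∧ F ⊆ L ∧ d + F.card = t ∧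
      (∀ a ∈ F, g a ≤ t) ∧ (∀ a ∈ L, g a = t → a ∈ F) := by
  have mid : ∀ t, d < t → (t = 2 ∨ t = 3) → (L.filter (fun a => g a = t)).card ≤ t - d →
      t - d ≤ (L.filter (fun a => g a ≤ t)).card → ∃ (t : ℕ) (F : Finset V), d < t ∧
      (t = 2 ∨ t = 3 ∨ t = 5) ∧ F ⊆ L ∧ d + F.card = t ∧
      (∀ a ∈ F, g a ≤ t) ∧ (∀ a ∈ L, g a = t → a ∈ F) := by
    intro t h1 h2 h3 h4
    obtain ⟨F, hF1, hF2, hF3⟩ := Finset.exists_subsuperset_card_eq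
      (s := L.filter (fun a => g a = t)) (t := L.filter (fun a => g a ≤ t)) (n := t - d)
      (by intro a; simp only [Finset.mem_filter]; rintro ⟨h, rfl⟩; exact ⟨h, le_rfl⟩) h3 h4
    refine ⟨t, F, h1, by tauto, fun a ha => (Finset.mem_filter.1 (hF2 ha)).1, by omega,
      fun a ha => (Finset.mem_filter.1 (hF2 ha)).2, fun a ha h => hF1 (Finset.mem_filter.2 ⟨ha, h⟩)⟩
  have pos : ∀ t, d < t → 1 ≤ (L.filter (fun a => g a ≤ t)).card := fun t ht =>
    Finset.card_pos.2 ⟨a₀, Finset.mem_filter.2 ⟨h0, by omega⟩⟩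
  have last : 3 ≤ d + (L.filter (fun a => g a = 3)).card - 1 →
      5 - d ≤ L.card → ∃ (t : ℕ) (F : Finset V), d < t ∧
      (t = 2 ∨ t = 3 ∨ t = 5) ∧ F ⊆ L ∧ d + F.card = t ∧
      (∀ a ∈ F, g a ≤ t) ∧ (∀ a ∈ L, g a = t → a ∈ F) := by
    intro _ h
    obtain ⟨F, hF1, hF2⟩ := Finset.exists_subset_card_eq h
    exact ⟨5, F, by omega, by omega, hF1, by omega,
      fun a ha => (hg a (hF1 ha)).trans (by norm_num), fun a ha h => by have := hg a ha; omega⟩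
  have ins : (L.filter (fun a => g a = 3)).card + 1 ≤ L.card := by
    rw [← Finset.card_insert_of_notMem (a := a₀)]
    · apply Finset.card_le_card
      intro a ha
      rcases Finset.mem_insert.1 ha with rfl | h
      · exact h0
      · exact (Finset.mem_filter.1 h).1
    · simp only [Finset.mem_filter, not_and]; omega
  rcases hd with rfl | rfl
  · by_cases h2 : (L.filter (fun a => g a = 2)).card ≤ 1
    · exact mid 2 (by omega) (by omega) h2 (pos 2 (by omega))
    · by_cases h3 : (L.filter (fun a => g a = 3)).card ≤ 2
      · refine mid 3 (by omega) (by omega) h3 ?_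
        have : (L.filter (fun a => g a = 2)).card ≤ (L.filter (fun a => g a ≤ 3)).card := by
          apply Finset.card_le_card
          intro a
          simp only [Finset.mem_filter]
          rintro ⟨h, h'⟩
          exact ⟨h, by omega⟩
        omega
      · exact last (by omega) (by omega)
  · by_cases h3 : (L.filter (fun a => g a = 3)).card ≤ 1
    · exact mid 3 (by omega) (by omega) h3 (pos 3 (by omega))
    · exact last (by omega) (by omega)

/-- Total outdegree of a colour class. -/
def tot {G : SimpleGraph V} (col : V → Bool) (c : Bool) (o : GOrientation G) : ℕ :=
  ∑ x ∈ Finset.univ.filter (fun x => col x = c), o.outDeg x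

lemma tot_le {G : SimpleGraph V} (col : V → Bool) (c : Bool) (o : GOrientation G) (k : ℕ)
    (h : ∀ x, col x = c → o.outDeg x ≤ k) : tot col c o ≤ Fintype.card V * k := by
  refine le_trans (Finset.sum_le_card_nsmul _ _ k ?_) ?_
  · intro x hx
    exact h x (Finset.mem_filter.1 hx).2
  · rw [smul_eq_mul]
    exact Nat.mul_le_mul_right _ (Finset.card_le_univ _)

lemma tot_flp {G : SimpleGraph V} (col : V → Bool) (o : GOrientation G) (b : V) (F : Finset V) (hF)
    (hcol : ∀ a ∈ F, col a ≠ col b) (hpos : 0 < F.card) :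
    tot col (col b) o < tot col (col b) (flp o b F hF) := by
  refine Finset.sum_lt_sum ?_ ⟨b, by simp, ?_⟩
  · intro x hx
    have hx' := (Finset.mem_filter.1 hx).2
    by_cases hxb : x = b
    · subst hxb
      rw [flp_out_b]; omega
    · rw [flp_out_other _ _ _ _ _ (fun h => hcol x h hx') hxb]
  · rw [flp_out_b]; omega

lemma proper_of_two (col : V → Bool) (G : SimpleGraph V) (hb : ∀ x y, G.Adj x y → col x ≠ col y)
    (h2 : ∃ o : GOrientation G, ∀ u, o.outDeg u ≤ 2) :
    ∃ o : GOrientation G, o.IsProper ∧ ∀ u, o.outDeg u ≤ 5 := by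
  have hdir : ∀ (o : GOrientation G) x y, o.dir x y = true → G.Adj x y := fun o x y h =>
    (o.adj_iff x y).2 (Or.inl h)
  obtain ⟨o₁, ⟨hA, hB⟩, hmax⟩ := exists_max
    (fun o : GOrientation G => (∀ a, col a = true → o.outDeg a ≤ 4) ∧
      (∀ b, col b = false → o.outDeg b ≤ 2)) (tot col true) (Fintype.card V * 4)
    (fun o h => tot_le col true o 4 h.1)
    (by
      obtain ⟨o, ho⟩ := h2
      exact ⟨o, fun a _ => (ho a).trans (by norm_num), fun b _ => ho b⟩)
  have hfull : ∀ a b, col a = true → o₁.outDeg a ≤ 3 → ¬ o₁.dir b a = true := by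
    intro a b ha ha3 hba
    have hF : ∀ x ∈ ({b} : Finset V), o₁.dir x a = true := by
      intro x hx
      rw [Finset.mem_singleton.1 hx]; exact hba
    have hcol := hb _ _ (hdir _ _ _ hba)
    have hlt := tot_flp col o₁ a {b} hF (by
      intro x hx
      rw [Finset.mem_singleton.1 hx]; exact hcol) (by simp)
    rw [ha] at hlt
    refine absurd (hmax (flp o₁ a {b} hF) ⟨?_, ?_⟩) (by omega)
    · intro x hx
      by_cases hxa : x = a
      · subst hxa
        rw [flp_out_b, Finset.card_singleton]; omega
      · rw [flp_out_other _ _ _ _ _ _ hxa]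
        · exact hA x hx
        · rw [Finset.mem_singleton]
          rintro rfl
          exact hcol (hx.trans ha.symm)
    · intro x hx
      have hxa : x ≠ a := by
        rintro rfl
        rw [hx] at ha
        exact absurd ha (by decide)
      by_cases hxb : x = b
      · have := flp_out_F o₁ a {b} hF x (by simp [hxb])
        have := hB x hx
        omega
      · rw [flp_out_other _ _ _ _ _ (by simpa using hxb) hxa]
        exact hB x hx
  obtain ⟨o, ⟨iA, iB, i3, i4⟩, hmax2⟩ := exists_max
    (fun o : GOrientation G => (∀ a, col a = true → o.outDeg a ≤ 4) ∧
      (∀ b, col b = false → o.outDeg b ≤ 3 ∨ o.outDeg b = 5) ∧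
      (∀ a b, col a = true → o.outDeg a ≤ 3 → o.dir b a = true → o.outDeg a < o.outDeg b) ∧
      (∀ a b, col a = true → o.dir a b = true → o.outDeg b = 3 → o.outDeg a ≠ 3))
    (tot col false) (Fintype.card V * 5)
    (fun o h => tot_le col false o 5 (fun x hx => by
      rcases h.2.1 x hx with h | h <;> omega))
    (by
      refine ⟨o₁, hA, fun b hb' => Or.inl ((hB b hb').trans (by norm_num)), ?_, ?_⟩
      · intro a b ha h3 hba
        exact absurd hba (hfull a b ha h3)
      · intro a b ha hab h3
        have : col b = false := by
          have := hb _ _ (hdir _ _ _ hab)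
          cases hc : col b
          · rfl
          · exact absurd (ha.trans hc.symm) this
        have := hB b this
        omega)
  have main : ∀ a b, col a = true → col b = false → G.Adj a b → o.outDeg a ≠ o.outDeg b := by
    intro a b ha hcb hab heq
    have hd3 : o.outDeg a ≤ 3 := by
      have := iA a ha
      rcases iB b hcb with h | h <;> omega
    have hdab : o.dir a b = true := by
      rcases (o.adj_iff a b).1 hab with h | h
      · exact h
      · have := i3 a b ha hd3 h
        omega
    have hn3 : o.outDeg b ≠ 3 := fun h => i4 a b ha hdab h (heq.trans h)
    have hpos : 1 ≤ o.outDeg a := Finset.card_pos.2 ⟨b, by simp [hdab]⟩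
    obtain ⟨t, F, hdt, ht, hFL, hFc, hFt, hFall⟩ := select
      (Finset.univ.filter (fun x => o.dir x b = true ∧ o.outDeg x ≤ 3)) o.outDeg
      (fun x hx => (Finset.mem_filter.1 hx).2.2) (o.outDeg b) (by omega) a
      (by simp [hdab, hd3]) heq
    have hF : ∀ x ∈ F, o.dir x b = true := fun x hx => (Finset.mem_filter.1 (hFL hx)).2.1
    have hF3 : ∀ x ∈ F, o.outDeg x ≤ 3 := fun x hx => (Finset.mem_filter.1 (hFL hx)).2.2
    have hFcol : ∀ x ∈ F, col x = true := by
      intro x hx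
      have := hb _ _ (hdir _ _ _ (hF x hx))
      rw [hcb] at this
      simpa using this
    have hbF : b ∉ F := fun h => by
      have := hFcol b h
      rw [hcb] at this
      exact absurd this (by decide)
    have hlt := tot_flp col o b F hF (fun x hx => by rw [hFcol x hx, hcb]; decide) (by omega)
    rw [hcb] at hlt
    set o' := flp o b F hF with ho'
    have oB : o'.outDeg b = t := by rw [ho', flp_out_b]; exact hFc
    have oF : ∀ x ∈ F, o'.outDeg x + 1 = o.outDeg x := fun x hx => flp_out_F o b F hF x hx
    have oO : ∀ x, x ∉ F → x ≠ b → o'.outDeg x = o.outDeg x := fun x h1 h2 =>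
      flp_out_other o b F hF x h1 h2
    have oD : ∀ x y, o'.dir x y = true ↔
      ((o.dir x y = true ∧ ¬ (y = b ∧ x ∈ F)) ∨ (x = b ∧ y ∈ F)) := flp_dir o b F hF
    have hne : ∀ x, col x = true → x ≠ b := by
      rintro x hx rfl
      rw [hcb] at hx
      exact absurd hx (by decide)
    have colf : ∀ x y, col x = true → G.Adj x y → col y = false := by
      intro x y hx h
      have := hb _ _ h
      rw [hx] at this
      simpa using this.symm
    have oBge : ∀ y, col y = false → o.outDeg y ≤ o'.outDeg y := by
      intro y hy
      by_cases hyb : y = b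
      · subst hyb; omega
      · rw [oO y (fun h => by have := hFcol y h; rw [hy] at this; exact absurd this (by decide)) hyb]
    have oAle : ∀ x, col x = true → o'.outDeg x ≤ o.outDeg x := by
      intro x hx
      by_cases hxF : x ∈ F
      · have := oF x hxF; omega
      · rw [oO x hxF (hne x hx)]
    refine absurd (hmax2 o' ⟨?_, ?_, ?_, ?_⟩) (by omega)
    · intro x hx
      exact (oAle x hx).trans (iA x hx)
    · intro y hy
      by_cases hyb : y = b
      · subst hyb; omega
      · rw [oO y (fun h => by have := hFcol y h; rw [hy] at this; exact absurd this (by decide)) hyb]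
        exact iB y hy
    · intro x y hx hx3 hyx
      have hlow : o.outDeg x ≤ 3 := by
        by_cases hxF : x ∈ F
        · exact hF3 x hxF
        · rw [← oO x hxF (hne x hx)]; exact hx3
      rcases (oD y x).1 hyx with ⟨h, -⟩ | ⟨rfl, h⟩
      · have h1 := i3 x y hx hlow h
        have h2 := oBge y (colf x y hx (hdir _ _ _ h).symm)
        have h3 := oAle x hx
        omega
      · have h1 := oF x h
        have h2 := hFt x h
        omega
    · intro x y hx hxy hy3 hx3
      have hxF : x ∉ F := fun h => by
        have h1 := oF x h
        have h2 := hF3 x h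
        omega
      have hox : o.outDeg x = 3 := by rw [← oO x hxF (hne x hx)]; exact hx3
      rcases (oD x y).1 hxy with ⟨h, -⟩ | ⟨h, -⟩
      · by_cases hyb : y = b
        · subst hyb
          exact hxF (hFall x (by simp [h, hox]) (by omega))
        · have hy := colf x y hx (hdir _ _ _ h)
          rw [oO y (fun h => by have := hFcol y h; rw [hy] at this; exact absurd this (by decide))
            hyb] at hy3
          exact i4 x y hx h hy3 hox
      · exact hne x hx h
  refine ⟨o, ?_, ?_⟩
  · intro u v huv
    have hc := hb _ _ huv
    cases hu : col u
    · have hv : col v = true := by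
        rw [hu] at hc
        simpa using hc.symm
      exact (main v u hv hu huv.symm).symm
    · have hv : col v = false := by
        rw [hu] at hc
        simpa using hc.symm
      exact main u v hu hv huv
  · intro u
    cases hu : col u
    · rcases iB u hu with h | h <;> omega
    · exact (iA u hu).trans (by norm_num)

end PO

theorem stmt9 {V : Type*} [Fintype V] (G : SimpleGraph V)
    (hG : IsPlanar G) (hbip : G.Colorable 2) :
    ∃ o : GOrientation G, o.IsProper ∧ ∀ u, o.outDeg u ≤ 5 := by
  obtain ⟨C⟩ := hbip
  have hb : ∀ x y, G.Adj x y → (decide (C x = 0)) ≠ (decide (C y = 0)) := by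
    intro x y h
    have := C.valid h
    have h1 : ∀ a b : Fin 2, a ≠ b → decide (a = 0) ≠ decide (b = 0) := by decide
    exact h1 _ _ this
  have hK : ¬ PO.K33 G := fun h => hG.2 h.hasMinor
  exact PO.proper_of_two (fun x => decide (C x = 0)) G hb
    (PO.exists_two _ G hb (PO.dens_sub _ G hb hK))
end

section
/- Every finite simple 3-colorable planar graph G satisfies χ⃗(G) ≤ 11. -/
open SimpleGraph Finset

section Comb
variable {V : Type*} [Fintype V] {G : SimpleGraph V}

def IsOr (G : SimpleGraph V) (E : V → V → Prop) : Prop :=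
  (∀ u v, G.Adj u v ↔ (E u v ∨ E v u)) ∧ ∀ u v, ¬(E u v ∧ E v u)

open Classical in
noncomputable def od (E : V → V → Prop) (u : V) : ℕ := (Finset.univ.filter fun v => E u v).card

open Classical in
noncomputable def av (G : SimpleGraph V) (E : V → V → Prop) (Z : Finset V) (u : V) : ℕ :=
  (Finset.univ.filter fun v => G.Adj u v ∧ ¬(v ∈ Z ∧ E v u)).card

open Classical in
lemma op_lemma (E : V → V → Prop) (hE : IsOr G E) (Z N : Finset V) (hZN : Disjoint Z N)
    (hN : ∀ p ∈ N, ∀ q ∈ N, ¬ G.Adj p q) (T : V → Finset V)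
    (hT : ∀ p ∈ N, ∀ u ∈ T p, u ∉ Z ∧ E u p) :
    ∃ E' : V → V → Prop, IsOr G E' ∧ (∀ z ∈ Z, od E' z = od E z) ∧
      (∀ p ∈ N, od E' p + (T p).card = av G E Z p) ∧
      (∀ u, u ∉ Z → u ∉ N → od E' u ≤ od E u) ∧
      (∀ u, u ∉ Z → u ∉ N →
        av G E' (Z ∪ N) u + (N.filter fun p => G.Adj p u ∧ u ∉ T p).card ≤ av G E Z u) := by
  have hZN' : ∀ z, z ∈ Z → z ∉ N := fun z hz hn => (Finset.disjoint_left.mp hZN) hz hn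
  -- new orientation
  let F : V → V → Prop := fun u v =>
    if u ∈ N ∧ v ∉ Z then G.Adj u v ∧ v ∉ T u
    else if v ∈ N ∧ u ∉ Z then u ∈ T v ∧ G.Adj u v
    else E u v
  have hFp : ∀ p v, p ∈ N → v ∉ Z → (F p v ↔ G.Adj p v ∧ v ∉ T p) := by
    intro p v hp hv; simp [F, hp, hv]
  have hFq : ∀ p v, p ∈ N → v ∉ Z → v ∉ N → (F v p ↔ v ∈ T p ∧ G.Adj v p) := by
    intro p v hp hv hv'; simp [F, hp, hv, hv']
  have hFz : ∀ z v, z ∈ Z → (F z v ↔ E z v) := by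
    intro z v hz; simp [F, hz, hZN' z hz]
  have hFz' : ∀ z v, z ∈ Z → (F v z ↔ E v z) := by
    intro z v hz; simp [F, hz, hZN' z hz]
  have hFo : ∀ u v, u ∉ N → v ∉ N → (F u v ↔ E u v) := by
    intro u v hu hv; simp [F, hu, hv]
  have hadj : ∀ u v, E u v → G.Adj u v := fun u v h => (hE.1 u v).2 (Or.inl h)
  have hadj' : ∀ u v, E u v → G.Adj v u := fun u v h => (hadj u v h).symm
  have hTadj : ∀ p ∈ N, ∀ u ∈ T p, G.Adj u p := fun p hp u hu => hadj _ _ (hT p hp u hu).2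
  have hFadj : ∀ u v, F u v → G.Adj u v := by
    intro u v h
    simp only [F] at h
    split_ifs at h
    · exact h.1
    · exact h.2
    · exact hadj _ _ h
  have hOr : IsOr G F := by
    refine ⟨fun u v => ⟨fun h => ?_, ?_⟩, fun u v => ?_⟩
    · by_cases huZ : u ∈ Z
      · rw [hFz u v huZ, hFz' u v huZ]; exact (hE.1 u v).1 h
      by_cases hvZ : v ∈ Z
      · rw [hFz v u hvZ, hFz' v u hvZ]; exact (hE.1 u v).1 h
      by_cases huN : u ∈ N
      · have hvN : v ∉ N := fun hv => hN u huN v hv h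
        rw [hFp u v huN hvZ, hFq u v huN hvZ hvN]
        by_cases hvT : v ∈ T u
        · exact Or.inr ⟨hvT, h.symm⟩
        · exact Or.inl ⟨h, hvT⟩
      by_cases hvN : v ∈ N
      · rw [hFp v u hvN huZ, hFq v u hvN huZ huN]
        by_cases hvT : u ∈ T v
        · exact Or.inl ⟨hvT, h⟩
        · exact Or.inr ⟨h.symm, hvT⟩
      rw [hFo u v huN hvN, hFo v u hvN huN]; exact (hE.1 u v).1 h
    · rintro (h | h)
      · exact hFadj _ _ h
      · exact (hFadj _ _ h).symm
    · rintro ⟨h1, h2⟩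
      have h := hFadj _ _ h1
      by_cases huZ : u ∈ Z
      · rw [hFz u v huZ] at h1; rw [hFz' u v huZ] at h2; exact hE.2 _ _ ⟨h1, h2⟩
      by_cases hvZ : v ∈ Z
      · rw [hFz v u hvZ] at h2; rw [hFz' v u hvZ] at h1; exact hE.2 _ _ ⟨h1, h2⟩
      by_cases huN : u ∈ N
      · have hvN : v ∉ N := fun hv => hN u huN v hv h
        rw [hFp u v huN hvZ] at h1; rw [hFq u v huN hvZ hvN] at h2
        exact h1.2 h2.1
      by_cases hvN : v ∈ N
      · rw [hFp v u hvN huZ] at h2; rw [hFq v u hvN huZ huN] at h1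
        exact h2.2 h1.1
      rw [hFo u v huN hvN] at h1; rw [hFo v u hvN huN] at h2; exact hE.2 _ _ ⟨h1, h2⟩
  refine ⟨F, hOr, ?_, ?_, ?_, ?_⟩
  · intro z hz
    unfold od
    congr 1
    ext v; simp [hFz z v hz]
  · intro p hp
    have hpZ : p ∉ Z := fun h => hZN' p h hp
    unfold od av
    rw [← Finset.card_union_of_disjoint]
    · congr 1
      ext v
      simp only [mem_union, mem_filter, mem_univ, true_and]
      by_cases hv : v ∈ Z
      · rw [hFz' v p hv]
        have : v ∉ T p := fun h => (hT p hp v h).1 hv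
        have := hE.1 p v
        have := hE.2 p v
        tauto
      · rw [hFp p v hp hv]
        have := hTadj p hp v
        have h2 := G.adj_comm p v
        tauto
    · rw [Finset.disjoint_left]
      intro v hv hv'
      simp only [mem_filter, mem_univ, true_and] at hv
      rw [hFp p v hp (hT p hp v hv').1] at hv
      exact hv.2 hv'
  · intro u hu huN
    unfold od
    apply Finset.card_le_card
    intro v
    simp only [mem_filter, mem_univ, true_and]
    intro h
    by_cases hvZ : v ∈ Z
    · exact (hFz' v u hvZ).1 h
    by_cases hvN : v ∈ N
    · exact (hT v hvN u ((hFq v u hvN hu huN).1 h).1).2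
    · exact (hFo u v huN hvN).1 h
  · intro u hu huN
    unfold av
    rw [← Finset.card_union_of_disjoint]
    · apply Finset.card_le_card
      intro v
      simp only [mem_union, mem_filter, mem_univ, true_and]
      rintro (⟨h1, h2⟩ | ⟨h1, h2, h3⟩)
      · refine ⟨h1, fun ⟨hz, he⟩ => h2 ⟨Or.inl hz, (hFz v u hz).2 he⟩⟩
      · exact ⟨h2.symm, fun ⟨hz, _⟩ => hZN' v hz h1⟩
    · rw [Finset.disjoint_left]
      intro v hv hv'
      simp only [mem_union, mem_filter, mem_univ, true_and] at hv hv'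
      exact hv.2 ⟨Or.inr hv'.1, (hFp v u hv'.1 hu).2 hv'.2⟩

open Classical in
lemma final_phase (n : ℕ) : ∀ (E : V → V → Prop) (_ : IsOr G E) (Z : Finset V)
    (_ : (Finset.univ \ Z).card = n)
    (_ : ∀ z ∈ Z, ∀ z' ∈ Z, G.Adj z z' → od E z ≠ od E z')
    (_ : ∀ z ∈ Z, ∀ u, u ∉ Z → G.Adj z u → av G E Z u < od E z)
    (_ : ∀ z ∈ Z, od E z ≤ 11) (_ : ∀ u, u ∉ Z → av G E Z u ≤ 11),
    ∃ E' : V → V → Prop, IsOr G E' ∧ (∀ u v, G.Adj u v → od E' u ≠ od E' v) ∧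
      ∀ u, od E' u ≤ 11 := by
  induction n with
  | zero =>
    intro E hE Z hc hp _ h11 _
    have hZ : ∀ v, v ∈ Z := by
      intro v
      by_contra hv
      have : v ∈ Finset.univ \ Z := by simp [hv]
      rw [Finset.card_eq_zero.mp hc] at this
      simp at this
    exact ⟨E, hE, fun u v h => hp u (hZ u) v (hZ v) h, fun u => h11 u (hZ u)⟩
  | succ n ih =>
    intro E hE Z hc hp hlt h11 ha
    have hne : (Finset.univ \ Z).Nonempty := by
      rw [← Finset.card_pos]; omega
    obtain ⟨u, hu, hmax⟩ := Finset.exists_max_image _ (av G E Z) hne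
    have huZ : u ∉ Z := by simpa using hu
    obtain ⟨E', hE', h1, h2, h3, h4⟩ := op_lemma E hE Z {u} (by simpa using huZ)
      (by intro p hp q hq; simp at hp hq; subst hp; subst hq; exact G.irrefl) (fun _ => ∅)
      (by simp)
    have h2' : od E' u = av G E Z u := by simpa using h2 u (by simp)
    have h4' : ∀ v, v ∉ Z → v ≠ u → av G E' (Z ∪ {u}) v ≤ av G E Z v := by
      intro v hv hvu
      have := h4 v hv (by simpa using hvu)
      omega
    have h4'' : ∀ v, v ∉ Z → v ≠ u → G.Adj u v → av G E' (Z ∪ {u}) v < av G E Z v := by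
      intro v hv hvu hadj
      have := h4 v hv (by simpa using hvu)
      have h5 : 0 < (Finset.filter (fun p => G.Adj p v ∧ v ∉ (∅ : Finset V)) {u}).card := by
        rw [Finset.card_pos]
        exact ⟨u, by simp [hadj]⟩
      omega
    have hm : ∀ v, v ∉ Z → av G E Z v ≤ av G E Z u := fun v hv => hmax v (by simpa using hv)
    refine ih E' hE' (Z ∪ {u}) ?_ ?_ ?_ ?_ ?_
    · have : Finset.univ \ (Z ∪ {u}) = (Finset.univ \ Z).erase u := by
        ext v; simp
      rw [this, Finset.card_erase_of_mem hu, hc]; omega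
    · intro z hz z' hz' hadj
      simp only [mem_union, mem_singleton] at hz hz'
      rcases hz with hz | rfl <;> rcases hz' with hz' | rfl
      · rw [h1 z hz, h1 z' hz']; exact hp z hz z' hz' hadj
      · rw [h1 z hz, h2']; exact (hlt z hz z' huZ hadj).ne'
      · rw [h1 z' hz', h2']; exact (hlt z' hz' z huZ hadj.symm).ne
      · exact absurd hadj (G.irrefl)
    · intro z hz v hv hadj
      simp only [mem_union, mem_singleton, not_or] at hz hv
      rcases hz with hz | rfl
      · rw [h1 z hz]; exact (h4' v hv.1 hv.2).trans_lt (hlt z hz v hv.1 hadj)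
      · rw [h2']; exact (h4'' v hv.1 hv.2 hadj).trans_le (hm v hv.1)
    · intro z hz
      simp only [mem_union, mem_singleton] at hz
      rcases hz with hz | rfl
      · rw [h1 z hz]; exact h11 z hz
      · rw [h2']; exact ha _ huZ
    · intro v hv
      simp only [mem_union, mem_singleton, not_or] at hv
      exact (h4' v hv.1 hv.2).trans (ha v hv.1)


end Comb
section Comb2
variable {V : Type*} [Fintype V] {G : SimpleGraph V}

open Classical in
lemma servers (s : V → ℕ) (In : Finset V) (n : ℕ) : ∀ (Y : Finset V) (_ : Y.card = n)
    (_ : ∀ X ⊆ Y, X.Nonempty → ∃ w ∈ In, (X.filter fun y => G.Adj w y).Nonempty ∧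
      (X.filter fun y => G.Adj w y).card ≤ s w),
    ∃ σ : V → Finset V, (∀ w, (σ w).card ≤ s w ∧ σ w ⊆ Y) ∧
      ∀ y ∈ Y, ∃ w ∈ In, G.Adj w y ∧ y ∈ σ w := by
  induction n using Nat.strong_induction_on with
  | _ n ih =>
    intro Y hY h
    by_cases hne : Y.Nonempty
    · obtain ⟨w, hw, hw1, hw2⟩ := h Y (Finset.Subset.refl _) hne
      have hsub : Y.filter (fun y => ¬ G.Adj w y) ⊂ Y := by
        refine ⟨Finset.filter_subset _ _, fun hs => ?_⟩
        obtain ⟨y, hy⟩ := hw1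
        rw [mem_filter] at hy
        have := hs hy.1
        rw [mem_filter] at this
        exact this.2 hy.2
      obtain ⟨σ, h1, h2⟩ := ih _ (hY ▸ Finset.card_lt_card hsub) _ rfl
        (fun X hX => h X (hX.trans hsub.1))
      refine ⟨fun x => if x = w then Y.filter (fun y => G.Adj w y) else σ x, ?_, ?_⟩
      · intro x
        by_cases hx : x = w
        · subst hx; simp only [if_true]; exact ⟨hw2, Finset.filter_subset _ _⟩
        · simp only [hx, if_false]; exact ⟨(h1 x).1, (h1 x).2.trans hsub.1⟩
      · intro y hy
        by_cases hyw : G.Adj w y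
        · exact ⟨w, hw, hyw, by simp [hy, hyw]⟩
        · obtain ⟨x, hx, hxy, hxσ⟩ := h2 y (by simp [hy, hyw])
          refine ⟨x, hx, hxy, ?_⟩
          have : x ≠ w := by rintro rfl; exact hyw hxy
          simpa [this] using hxσ
    · rw [Finset.not_nonempty_iff_eq_empty] at hne
      subst hne
      exact ⟨fun _ => ∅, by simp, by simp⟩

open Classical in
lemma stage (c : V → Fin 3) (hc : ∀ u v, G.Adj u v → c u ≠ c v)
    (E : V → V → Prop) (hE : IsOr G E) (Z : Finset V) (h3 : ∀ u, u ∉ Z → od E u ≤ 3)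
    (m : ℕ) (hm : 3 ≤ m) (o j1 j2 : Fin 3) (ho1 : o ≠ j1) (ho2 : o ≠ j2)
    (M : Finset V) (hM : ∀ y ∈ M, y ∉ Z ∧ av G E Z y = m ∧ (c y = j1 ∨ c y = j2))
    (hyp : M = ∅ ∨ (7 ≤ m ∧ ∀ w, w ∉ Z → c w = o → av G E Z w ≤ m + 2)) :
    ∃ (E' : V → V → Prop) (Z' : Finset V), IsOr G E' ∧ Z ⊆ Z' ∧ (∀ z ∈ Z, od E' z = od E z) ∧
      (∀ z ∈ Z', z ∉ Z → od E' z = m) ∧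
      (∀ z ∈ Z', z ∉ Z → ∀ y ∈ Z', y ∉ Z → ¬ G.Adj z y) ∧
      (∀ u, u ∉ Z' → od E' u ≤ 3) ∧
      (∀ u, u ∉ Z' → av G E' Z' u ≤ av G E Z u) ∧
      (∀ u, u ∉ Z' → c u = o → av G E' Z' u + 1 ≤ m) ∧
      (∀ y, y ∉ Z' → y ∈ M → av G E' Z' y + 1 ≤ m) := by
  let W : Finset V := Finset.univ.filter fun w => w ∉ Z ∧ c w = o ∧ m ≤ av G E Z w
  let s : V → ℕ := fun w => av G E Z w - m
  have hW : ∀ w, w ∈ W ↔ w ∉ Z ∧ c w = o ∧ m ≤ av G E Z w := by intro w; simp [W]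
  let good : Finset V → Prop := fun S => (∀ x ∈ S, ∀ y ∈ S, ¬ G.Adj x y) ∧
    ∀ w ∈ W, (S.filter fun y => G.Adj w y).Nonempty → s w + 1 ≤ (S.filter fun y => G.Adj w y).card
  have hgne : (M.powerset.filter good).Nonempty := ⟨∅, by simp [good]⟩
  obtain ⟨S, hS, hmax⟩ := Finset.exists_max_image _ Finset.card hgne
  rw [mem_filter, mem_powerset] at hS
  obtain ⟨hSM, hSi, hSg⟩ := hS
  let In : Finset V := W.filter fun w => ∀ y ∈ S, ¬ G.Adj w y
  let Q : Fin 3 → Finset V := fun j => M.filter fun y => y ∉ S ∧ (∀ x ∈ S, ¬ G.Adj x y) ∧ c y = j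
  have hserv : ∀ j, ∃ σ : V → Finset V, (∀ w, (σ w).card ≤ s w ∧ σ w ⊆ Q j) ∧
      ∀ y ∈ Q j, ∃ w ∈ In, G.Adj w y ∧ y ∈ σ w := by
    intro j
    refine servers s In _ (Q j) rfl ?_
    intro X hX hXne
    by_contra hcon
    push Not at hcon
    have hXQ : ∀ y ∈ X, y ∈ M ∧ y ∉ S ∧ (∀ x ∈ S, ¬ G.Adj x y) ∧ c y = j := by
      intro y hy; have := hX hy; simpa [Q] using this
    have hgood : good (S ∪ X) := by
      refine ⟨?_, ?_⟩
      · intro x hx y hy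
        rw [mem_union] at hx hy
        rcases hx with hx | hx <;> rcases hy with hy | hy
        · exact hSi x hx y hy
        · exact (hXQ y hy).2.2.1 x hx
        · exact fun h => (hXQ x hx).2.2.1 y hy h.symm
        · exact fun h => hc x y h ((hXQ x hx).2.2.2.trans (hXQ y hy).2.2.2.symm)
      · intro w hw hne
        by_cases hwS : (S.filter fun y => G.Adj w y).Nonempty
        · exact (hSg w hw hwS).trans (Finset.card_le_card
            (Finset.filter_subset_filter _ Finset.subset_union_left))
        · have hwIn : w ∈ In := by
            simp only [In, mem_filter]
            refine ⟨hw, fun y hy h => hwS ⟨y, by simp [hy, h]⟩⟩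
          have hne' : (X.filter fun y => G.Adj w y).Nonempty := by
            obtain ⟨y, hy⟩ := hne
            simp only [mem_filter, mem_union] at hy
            rcases hy with ⟨hy | hy, h⟩
            · exact absurd ⟨y, by simp [hy, h]⟩ hwS
            · exact ⟨y, by simp [hy, h]⟩
          exact (hcon w hwIn hne').trans_le' le_rfl |>.trans_le (Finset.card_le_card
            (Finset.filter_subset_filter _ Finset.subset_union_right))
    have := hmax (S ∪ X) (by
      rw [mem_filter, mem_powerset]
      exact ⟨Finset.union_subset hSM (fun y hy => (hXQ y hy).1), hgood⟩)
    have hdis : Disjoint S X := by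
      rw [Finset.disjoint_right]; intro y hy; exact (hXQ y hy).2.1
    rw [Finset.card_union_of_disjoint hdis] at this
    have := hXne.card_pos
    omega
  obtain ⟨σ1, hσ1, hs1⟩ := hserv j1
  obtain ⟨σ2, hσ2, hs2⟩ := hserv j2
  have hcount : ∀ w, w ∉ Z → av G E Z w ≤
      (Finset.univ.filter fun u => u ∉ Z ∧ E u w).card + od E w := by
    intro w _
    unfold av od
    refine le_trans (Finset.card_le_card ?_) (Finset.card_union_le _ _)
    intro v
    simp only [mem_union, mem_filter, mem_univ, true_and]
    have := hE.1 w v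
    tauto
  have hTex : ∀ w, ∃ T : Finset V, w ∈ In → (T.card = s w ∧ (∀ u ∈ T, u ∉ Z ∧ E u w) ∧
      ∀ u ∈ T, u ∉ σ1 w ∧ u ∉ σ2 w) := by
    intro w
    by_cases hw : w ∈ In
    swap
    · exact ⟨∅, fun h => absurd h hw⟩
    have hwW : w ∈ W := (Finset.mem_filter.mp hw).1
    have hw' := (hW w).1 hwW
    have hc1 := hcount w hw'.1
    have hc2 := h3 w hw'.1
    have hbig : s w ≤ ((Finset.univ.filter fun u => u ∉ Z ∧ E u w) \ (σ1 w ∪ σ2 w)).card := by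
      have hle := Finset.le_card_sdiff (σ1 w ∪ σ2 w) (Finset.univ.filter fun u => u ∉ Z ∧ E u w)
      refine le_trans ?_ hle
      rcases hyp with h0 | ⟨h7, h2⟩
      · have e1 : σ1 w = ∅ := Finset.subset_empty.mp ((hσ1 w).2.trans (by simp [Q, h0]))
        have e2 : σ2 w = ∅ := Finset.subset_empty.mp ((hσ2 w).2.trans (by simp [Q, h0]))
        rw [e1, e2]
        simp only [Finset.union_self, Finset.card_empty]
        simp only [s]; omega
      · have := Finset.card_union_le (σ1 w) (σ2 w)
        have a1 := (hσ1 w).1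
        have a2 := (hσ2 w).1
        have a3 := h2 w hw'.1 hw'.2.1
        simp only [s] at a1 a2 ⊢
        omega
    obtain ⟨T, hT1, hT2⟩ := Finset.exists_subset_card_eq hbig
    refine ⟨T, fun _ => ⟨hT2, fun u hu => ?_, fun u hu => ?_⟩⟩
    · have := hT1 hu; simp at this; exact this.1
    · have := hT1 hu; simp at this; exact this.2
  choose T0 hT0 using hTex
  let T : V → Finset V := fun w => if w ∈ In then T0 w else ∅
  have hInW : ∀ w ∈ In, w ∈ W := fun w hw => (Finset.mem_filter.mp hw).1
  have hInS : ∀ w ∈ In, ∀ y ∈ S, ¬ G.Adj w y := fun w hw => (Finset.mem_filter.mp hw).2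
  have hSIn : ∀ y ∈ S, y ∉ In := by
    intro y hy hin
    have h1 := ((hW y).1 (hInW y hin)).2.1
    rcases (hM y (hSM hy)).2.2 with h | h
    · exact ho1 (h1.symm.trans h)
    · exact ho2 (h1.symm.trans h)
  have hNZ : ∀ p ∈ S ∪ In, p ∉ Z := by
    intro p hp
    rw [mem_union] at hp
    rcases hp with hp | hp
    · exact (hM p (hSM hp)).1
    · exact ((hW p).1 (hInW p hp)).1
  have hind : ∀ p ∈ S ∪ In, ∀ q ∈ S ∪ In, ¬ G.Adj p q := by
    intro p hp q hq
    rw [mem_union] at hp hq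
    rcases hp with hp | hp <;> rcases hq with hq | hq
    · exact hSi p hp q hq
    · exact fun h => hInS q hq p hp h.symm
    · exact hInS p hp q hq
    · exact fun h => hc p q h
        (((hW p).1 (hInW p hp)).2.1.trans ((hW q).1 (hInW q hq)).2.1.symm)
  obtain ⟨E', hE', g1, g2, g3, g4⟩ := op_lemma E hE Z (S ∪ In)
    (Finset.disjoint_right.mpr hNZ) hind T (by
      intro p hp u hu
      by_cases hpI : p ∈ In
      · simp only [T, hpI, if_true] at hu
        exact (hT0 p hpI).2.1 u hu
      · simp [T, hpI] at hu)
  have hnot : ∀ u, u ∉ Z ∪ (S ∪ In) → u ∉ Z ∧ u ∉ S ∪ In := by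
    intro u hu; rw [mem_union] at hu; tauto
  have havle : ∀ u, u ∉ Z ∪ (S ∪ In) → av G E' (Z ∪ (S ∪ In)) u ≤ av G E Z u := by
    intro u hu
    obtain ⟨a, b⟩ := hnot u hu
    have := g4 u a b
    omega
  refine ⟨E', Z ∪ (S ∪ In), hE', Finset.subset_union_left, g1, ?_, ?_, ?_, havle, ?_, ?_⟩
  · intro z hz hzZ
    have hz' : z ∈ S ∪ In := by rw [mem_union] at hz; tauto
    have h := g2 z hz'
    by_cases hzI : z ∈ In
    · have h1 := (hT0 z hzI).1
      have h2 := ((hW z).1 (hInW z hzI)).2.2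
      simp only [T, hzI, if_true, h1, s] at h
      omega
    · have hzS : z ∈ S := by rw [mem_union] at hz'; tauto
      have h1 := (hM z (hSM hzS)).2.1
      simp only [T, hzI, if_false, Finset.card_empty] at h
      omega
  · intro z hz hzZ y hy hyZ
    refine hind z ?_ y ?_
    · rw [mem_union] at hz; tauto
    · rw [mem_union] at hy; tauto
  · intro u hu
    obtain ⟨a, b⟩ := hnot u hu
    exact (g3 u a b).trans (h3 u a)
  · intro u hu hcu
    obtain ⟨a, b⟩ := hnot u hu
    by_cases hav : m ≤ av G E Z u
    · have huW : u ∈ W := (hW u).2 ⟨a, hcu, hav⟩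
      have huI : u ∉ In := fun h => b (by simp [h])
      have hne : (S.filter fun y => G.Adj u y).Nonempty := by
        by_contra hne
        apply huI
        simp only [In, mem_filter]
        exact ⟨huW, fun y hy h => hne ⟨y, by simp [hy, h]⟩⟩
      have h1 := hSg u huW hne
      have h2 := g4 u a b
      have h5 : (S.filter fun y => G.Adj u y).card ≤
          ((S ∪ In).filter fun p => G.Adj p u ∧ u ∉ T p).card := by
        apply Finset.card_le_card
        intro y hy
        simp only [mem_filter, mem_union] at hy ⊢
        refine ⟨Or.inl hy.1, hy.2.symm, ?_⟩
        simp [T, hSIn y hy.1]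
      simp only [s] at h1
      omega
    · have := havle u hu
      omega
  · intro y hy hyM
    obtain ⟨a, b⟩ := hnot y hy
    have hyS : y ∉ S := fun h => b (by simp [h])
    have hex : ∃ p ∈ S ∪ In, G.Adj p y ∧ y ∉ T p := by
      by_cases hadj : ∀ x ∈ S, ¬ G.Adj x y
      · rcases (hM y hyM).2.2 with hcy | hcy
        · obtain ⟨w, hw, hwy, hyσ⟩ := hs1 y (by simp only [Q, mem_filter]; exact ⟨hyM, hyS, hadj, hcy⟩)
          refine ⟨w, by simp [hw], hwy, ?_⟩
          simp only [T, hw, if_true]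
          exact fun h => ((hT0 w hw).2.2 y h).1 hyσ
        · obtain ⟨w, hw, hwy, hyσ⟩ := hs2 y (by simp only [Q, mem_filter]; exact ⟨hyM, hyS, hadj, hcy⟩)
          refine ⟨w, by simp [hw], hwy, ?_⟩
          simp only [T, hw, if_true]
          exact fun h => ((hT0 w hw).2.2 y h).2 hyσ
      · push Not at hadj
        obtain ⟨x, hx, hxy⟩ := hadj
        exact ⟨x, by simp [hx], hxy, by simp [T, hSIn x hx]⟩
    obtain ⟨p, hp, hpy⟩ := hex
    have h5 : 0 < ((S ∪ In).filter fun p => G.Adj p y ∧ y ∉ T p).card :=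
      Finset.card_pos.mpr ⟨p, by rw [mem_filter]; exact ⟨hp, hpy⟩⟩
    have h6 := g4 y a b
    have h7 := (hM y hyM).2.1
    omega

/-- The state after some stages: everything placed is proper, with outdegrees in `[k, 11]`. -/
def StInv (G : SimpleGraph V) (E : V → V → Prop) (Z : Finset V) (k : ℕ) : Prop :=
  IsOr G E ∧ (∀ u, u ∉ Z → od E u ≤ 3) ∧ (∀ z ∈ Z, k ≤ od E z ∧ od E z ≤ 11) ∧
    ∀ z ∈ Z, ∀ z' ∈ Z, G.Adj z z' → od E z ≠ od E z'

open Classical in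
lemma stageInv (c : V → Fin 3) (hc : ∀ u v, G.Adj u v → c u ≠ c v)
    (E : V → V → Prop) (Z : Finset V) (m : ℕ) (hI : StInv G E Z (m + 1))
    (hm : 3 ≤ m) (hm' : m ≤ 11) (o j1 j2 : Fin 3) (ho1 : o ≠ j1) (ho2 : o ≠ j2)
    (M : Finset V) (hM : ∀ y ∈ M, y ∉ Z ∧ av G E Z y = m ∧ (c y = j1 ∨ c y = j2))
    (hyp : M = ∅ ∨ (7 ≤ m ∧ ∀ w, w ∉ Z → c w = o → av G E Z w ≤ m + 2)) :
    ∃ (E' : V → V → Prop) (Z' : Finset V), StInv G E' Z' m ∧ Z ⊆ Z' ∧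
      (∀ u, u ∉ Z' → av G E' Z' u ≤ av G E Z u) ∧
      (∀ u, u ∉ Z' → c u = o → av G E' Z' u + 1 ≤ m) ∧
      (∀ y, y ∉ Z' → y ∈ M → av G E' Z' y + 1 ≤ m) := by
  obtain ⟨hE, h3, hk, hp⟩ := hI
  obtain ⟨E', Z', a1, a2, a3, a4, a5, a6, a7, a8, a9⟩ :=
    stage c hc E hE Z h3 m hm o j1 j2 ho1 ho2 M hM hyp
  refine ⟨E', Z', ⟨a1, a6, ?_, ?_⟩, a2, a7, a8, a9⟩
  · intro z hz
    by_cases hzZ : z ∈ Z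
    · have := hk z hzZ
      rw [a3 z hzZ]; omega
    · rw [a4 z hz hzZ]; omega
  · intro z hz z' hz' hadj
    by_cases h1 : z ∈ Z <;> by_cases h2 : z' ∈ Z
    · rw [a3 z h1, a3 z' h2]; exact hp z h1 z' h2 hadj
    · rw [a3 z h1, a4 z' hz' h2]; have := hk z h1; omega
    · rw [a3 z' h2, a4 z hz h1]; have := hk z' h2; omega
    · exact absurd hadj (a5 z hz h1 z' hz' h2)

open Classical in
lemma main_comb (c : V → Fin 3) (hc : ∀ u v, G.Adj u v → c u ≠ c v)
    (E : V → V → Prop) (hE : IsOr G E) (h3 : ∀ u, od E u ≤ 3) :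
    ∃ E' : V → V → Prop, IsOr G E' ∧ (∀ u v, G.Adj u v → od E' u ≠ od E' v) ∧
      ∀ u, od E' u ≤ 11 := by
  have I0 : StInv G E ∅ 12 := ⟨hE, fun u _ => h3 u, by simp, by simp⟩
  obtain ⟨E1, Z1, I1, -, m1, o1, -⟩ := stageInv c hc E ∅ 11 I0 (by omega) (by omega) 2 0 0
    (by decide) (by decide) ∅ (by simp) (Or.inl rfl)
  obtain ⟨E2, Z2, I2, s2, m2, o2, -⟩ := stageInv c hc E1 Z1 10 I1 (by omega) (by omega) 1 0 0
    (by decide) (by decide) ∅ (by simp) (Or.inl rfl)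
  obtain ⟨E3, Z3, I3, s3, m3, o3, -⟩ := stageInv c hc E2 Z2 9 I2 (by omega) (by omega) 0 1 1
    (by decide) (by decide) ∅ (by simp) (Or.inl rfl)
  obtain ⟨E4, Z4, I4, s4, m4, o4, q4⟩ := stageInv c hc E3 Z3 8 I3 (by omega) (by omega) 2 0 0
    (by decide) (by decide)
    (Finset.univ.filter fun y => y ∉ Z3 ∧ av G E3 Z3 y = 8 ∧ c y = 0)
    (by intro y hy; simp at hy; tauto)
    (Or.inr ⟨by omega, fun w hw hcw => by
      have h1 : w ∉ Z2 := fun h => hw (s3 h)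
      have h2 : w ∉ Z1 := fun h => h1 (s2 h)
      have := m3 w hw
      have := m2 w h1
      have := o1 w h2 hcw
      omega⟩)
  obtain ⟨E5, Z5, I5, s5, m5, o5, q5⟩ := stageInv c hc E4 Z4 7 I4 (by omega) (by omega) 1 0 2
    (by decide) (by decide)
    (Finset.univ.filter fun y => y ∉ Z4 ∧ av G E4 Z4 y = 7 ∧ (c y = 0 ∨ c y = 2))
    (by intro y hy; simp at hy; tauto)
    (Or.inr ⟨by omega, fun w hw hcw => by
      have h1 : w ∉ Z3 := fun h => hw (s4 h)
      have h2 : w ∉ Z2 := fun h => h1 (s3 h)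
      have := m4 w hw
      have := m3 w h1
      have := o2 w h2 hcw
      omega⟩)
  have h6 : ∀ u, u ∉ Z5 → av G E5 Z5 u ≤ 6 := by
    intro u hu
    have hu4 : u ∉ Z4 := fun h => hu (s5 h)
    have hu3 : u ∉ Z3 := fun h => hu4 (s4 h)
    have b5 := m5 u hu
    have hcases : c u = 0 ∨ c u = 1 ∨ c u = 2 := by
      have : ∀ x : Fin 3, x = 0 ∨ x = 1 ∨ x = 2 := by decide
      exact this _
    have key : (c u = 0 ∨ c u = 2) → av G E4 Z4 u ≤ 7 → av G E5 Z5 u ≤ 6 := by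
      intro hcu hle
      by_cases h : av G E4 Z4 u = 7
      · have := q5 u hu (by simp only [mem_filter, mem_univ, true_and]; exact ⟨hu4, h, hcu⟩)
        omega
      · omega
    rcases hcases with h | h | h
    · apply key (Or.inl h)
      have c3 := o3 u hu3 h
      have b4 := m4 u hu4
      by_cases h8 : av G E3 Z3 u = 8
      · have := q4 u hu4 (by simp only [mem_filter, mem_univ, true_and]; exact ⟨hu3, h8, h⟩)
        omega
      · omega
    · have := o5 u hu h
      omega
    · apply key (Or.inr h)
      have := o4 u hu4 h
      omega
  obtain ⟨hE5, -, hk, hp⟩ := I5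
  refine final_phase _ E5 hE5 Z5 rfl hp ?_ (fun z hz => (hk z hz).2) ?_
  · intro z hz u hu _
    have := hk z hz
    have := h6 u hu
    omega
  · intro u hu
    have := h6 u hu
    omega
end Comb2
section Mader
variable {V : Type*}

/-- A `K₅` minor of `H` with all branch sets inside `S`. -/
def K5on (H : SimpleGraph V) (S : Set V) : Prop :=
  ∃ B : Fin 5 → Set V,
    (∀ w, (B w).Nonempty ∧ B w ⊆ S) ∧
    (∀ w, (H.induce (B w)).Connected) ∧
    (∀ w₁ w₂, w₁ ≠ w₂ → Disjoint (B w₁) (B w₂)) ∧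
    (∀ w₁ w₂, w₁ ≠ w₂ → ∃ u ∈ B w₁, ∃ v ∈ B w₂, H.Adj u v)

lemma reach_map {α β : Type*} {A : SimpleGraph α} {K : SimpleGraph β} (f : α → β)
    (h : ∀ a b, A.Adj a b → K.Reachable (f a) (f b)) {a b : α} (hab : A.Reachable a b) :
    K.Reachable (f a) (f b) := by
  obtain ⟨p⟩ := hab
  induction p with
  | nil => exact Reachable.refl _
  | cons hadj _ ih => exact (h _ _ hadj).trans ih

lemma K5on.mono {H H' : SimpleGraph V} {S S' : Set V} (hle : H ≤ H') (hS : S ⊆ S')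
    (h : K5on H S) : K5on H' S' := by
  obtain ⟨B, h1, h2, h3, h4⟩ := h
  refine ⟨B, fun w => ⟨(h1 w).1, (h1 w).2.trans hS⟩, fun w => ?_, h3, fun a b hab => ?_⟩
  · exact (h2 w).mono (SimpleGraph.comap_monotone _ hle)
  · obtain ⟨u, hu, v, hv, huv⟩ := h4 a b hab
    exact ⟨u, hu, v, hv, hle huv⟩

lemma K5on.hasMinor {H : SimpleGraph V} {S : Set V} (h : K5on H S) :
    HasMinor H (completeGraph (Fin 5)) := by
  obtain ⟨B, h1, h2, h3, h4⟩ := h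
  refine ⟨B, fun w => (h1 w).1, h2, h3, fun a b hab => h4 a b ?_⟩
  simpa using hab

/-- Contraction of `v` into `u`. -/
def contr (H : SimpleGraph V) (u v : V) : SimpleGraph V where
  Adj x y := x ≠ y ∧ x ≠ v ∧ y ≠ v ∧ (H.Adj x y ∨ (x = u ∧ H.Adj v y) ∨ (y = u ∧ H.Adj v x))
  symm := ⟨fun x y h => ⟨h.1.symm, h.2.2.1, h.2.1, by
    rcases h.2.2.2 with h | h | h
    · exact Or.inl h.symm
    · exact Or.inr (Or.inr h)
    · exact Or.inr (Or.inl h)⟩⟩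
  loopless := ⟨fun x h => h.1 rfl⟩

lemma K5on_of_contr {H : SimpleGraph V} {S : Set V} {u v : V} (huv : H.Adj u v) (hv : v ∈ S)
    (h : K5on (contr H u v) (S \ {v})) : K5on H S := by
  classical
  obtain ⟨B, h1, h2, h3, h4⟩ := h
  have hvB : ∀ w, v ∉ B w := fun w hw => ((h1 w).2 hw).2 rfl
  let B' : Fin 5 → Set V := fun w => {x | x ∈ B w ∨ (x = v ∧ u ∈ B w)}
  have hsub : ∀ w, B w ⊆ B' w := fun w x hx => Or.inl hx
  have huniq : ∀ a b, a ≠ b → u ∈ B a → u ∈ B b → False := fun a b hab ha hb =>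
    Set.disjoint_left.mp (h3 a b hab) ha hb
  refine ⟨B', fun w => ⟨(h1 w).1.mono (hsub w), ?_⟩, fun w => ?_, fun a b hab => ?_,
    fun a b hab => ?_⟩
  · rintro x (hx | ⟨rfl, _⟩)
    · exact ((h1 w).2 hx).1
    · exact hv
  · have key : ∀ a b : B w, ((contr H u v).induce (B w)).Adj a b →
        (H.induce (B' w)).Reachable ⟨a, hsub w a.2⟩ ⟨b, hsub w b.2⟩ := by
      rintro ⟨a, ha⟩ ⟨b, hb⟩ hab
      have hab' : (contr H u v).Adj a b := hab
      obtain ⟨_, _, _, hab' | ⟨rfl, hab'⟩ | ⟨rfl, hab'⟩⟩ := hab'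
      · exact Adj.reachable (G := H.induce (B' w)) (u := ⟨a, hsub w ha⟩) (v := ⟨b, hsub w hb⟩) hab'
      · have hvw : v ∈ B' w := Or.inr ⟨rfl, ha⟩
        exact (Adj.reachable (G := H.induce (B' w)) (u := ⟨a, hsub w ha⟩) (v := ⟨v, hvw⟩) huv).trans
          (Adj.reachable (G := H.induce (B' w)) (u := ⟨v, hvw⟩) (v := ⟨b, hsub w hb⟩) hab')
      · have hvw : v ∈ B' w := Or.inr ⟨rfl, hb⟩
        exact (Adj.reachable (G := H.induce (B' w)) (u := ⟨a, hsub w ha⟩) (v := ⟨v, hvw⟩)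
          hab'.symm).trans
          (Adj.reachable (G := H.induce (B' w)) (u := ⟨v, hvw⟩) (v := ⟨b, hsub w hb⟩) huv.symm)
    have hpre : ∀ a b : B w, (H.induce (B' w)).Reachable ⟨a, hsub w a.2⟩ ⟨b, hsub w b.2⟩ :=
      fun a b => reach_map (fun a : B w => (⟨a, hsub w a.2⟩ : B' w)) key ((h2 w).preconnected a b)
    have hcan : ∀ x : B' w, ∃ a : B w, (H.induce (B' w)).Reachable x ⟨a, hsub w a.2⟩ := by
      rintro ⟨x, hx | ⟨rfl, hu⟩⟩
      · exact ⟨⟨x, hx⟩, Reachable.refl _⟩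
      · exact ⟨⟨u, hu⟩, Adj.reachable (G := H.induce (B' w)) (u := ⟨x, Or.inr ⟨rfl, hu⟩⟩)
          (v := ⟨u, hsub w hu⟩) huv.symm⟩
    have : Nonempty (B' w) := ((h1 w).1.mono (hsub w)).to_subtype
    refine ⟨fun x y => ?_⟩
    obtain ⟨a, ha⟩ := hcan x
    obtain ⟨b, hb⟩ := hcan y
    exact ha.trans ((hpre a b).trans hb.symm)
  · rw [Set.disjoint_left]
    rintro x (hx | ⟨rfl, hx⟩) (hy | ⟨hxv, hy⟩)
    · exact Set.disjoint_left.mp (h3 a b hab) hx hy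
    · exact hvB a (hxv ▸ hx)
    · exact hvB b hy
    · exact huniq a b hab hx hy
  · obtain ⟨x, hx, y, hy, _, _, _, hxy | ⟨rfl, hxy⟩ | ⟨rfl, hxy⟩⟩ := h4 a b hab
    · exact ⟨x, hsub a hx, y, hsub b hy, hxy⟩
    · exact ⟨v, Or.inr ⟨rfl, hx⟩, y, hsub b hy, hxy⟩
    · exact ⟨x, hsub a hx, v, Or.inr ⟨rfl, hy⟩, hxy.symm⟩

lemma K5on_build {H : SimpleGraph V} {S : Set V} {v p q r1 r2 r3 : V}
    (hpq : p = q ∨ H.Adj p q) (hvp : H.Adj v p) (hvq : H.Adj v q)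
    (hv1 : H.Adj v r1) (hv2 : H.Adj v r2) (hv3 : H.Adj v r3)
    (h12 : H.Adj r1 r2) (h13 : H.Adj r1 r3) (h23 : H.Adj r2 r3)
    (h1 : r1 ≠ p ∧ r1 ≠ q ∧ (H.Adj r1 p ∨ H.Adj r1 q))
    (h2 : r2 ≠ p ∧ r2 ≠ q ∧ (H.Adj r2 p ∨ H.Adj r2 q))
    (h3 : r3 ≠ p ∧ r3 ≠ q ∧ (H.Adj r3 p ∨ H.Adj r3 q))
    (hS : ∀ x y, H.Adj x y → x ∈ S) : K5on H S := by
  have hpair : ∀ x y, (x = y ∨ H.Adj x y) → (H.induce {x, y}).Connected := by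
    intro x y hxy
    rw [connected_iff_exists_forall_reachable]
    refine ⟨⟨x, by simp⟩, ?_⟩
    rintro ⟨z, rfl | rfl⟩
    · exact Reachable.refl _
    · rcases hxy with rfl | hxy
      · exact Reachable.refl _
      · exact Adj.reachable (G := H.induce {x, z}) (u := ⟨x, by simp⟩) (v := ⟨z, by simp⟩) hxy
  have hsing : ∀ x, (H.induce {x}).Connected := by
    intro x
    simp
  let B : Fin 5 → Set V := ![{v}, {p, q}, {r1}, {r2}, {r3}]
  have hadj : ∀ a b : Fin 5, a < b → ∃ x ∈ B a, ∃ y ∈ B b, H.Adj x y := by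
    have hr : ∀ r, (H.Adj r p ∨ H.Adj r q) → ∃ x ∈ ({p, q} : Set V), ∃ y ∈ ({r} : Set V), H.Adj x y := by
      rintro r (h | h)
      · exact ⟨p, by simp, r, rfl, h.symm⟩
      · exact ⟨q, by simp, r, rfl, h.symm⟩
    intro a b hab
    fin_cases a <;> fin_cases b <;> first
      | exact absurd hab (by decide)
      | exact ⟨v, rfl, p, Or.inl rfl, hvp⟩
      | exact ⟨_, rfl, _, rfl, by assumption⟩
      | exact hr _ h1.2.2
      | exact hr _ h2.2.2
      | exact hr _ h3.2.2
  have hdis : ∀ a b : Fin 5, a < b → Disjoint (B a) (B b) := by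
    have e1 := hvp.ne
    have e2 := hvq.ne
    have e3 := hv1.ne
    have e4 := hv2.ne
    have e5 := hv3.ne
    have e6 := h12.ne
    have e7 := h13.ne
    have e8 := h23.ne
    intro a b hab
    rw [Set.disjoint_left]
    intro x hx hy
    fin_cases a <;> fin_cases b <;> first
      | exact absurd hab (by decide)
      | (simp [B] at hx hy; grind)
  refine ⟨B, ?_, ?_, ?_, ?_⟩
  · intro w
    fin_cases w
    · exact ⟨⟨v, rfl⟩, Set.singleton_subset_iff.mpr (hS _ _ hvp)⟩
    · refine ⟨⟨p, by simp [B]⟩, ?_⟩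
      rintro x (rfl | rfl)
      · exact hS _ _ hvp.symm
      · exact hS _ _ hvq.symm
    · exact ⟨⟨r1, rfl⟩, Set.singleton_subset_iff.mpr (hS _ _ hv1.symm)⟩
    · exact ⟨⟨r2, rfl⟩, Set.singleton_subset_iff.mpr (hS _ _ hv2.symm)⟩
    · exact ⟨⟨r3, rfl⟩, Set.singleton_subset_iff.mpr (hS _ _ hv3.symm)⟩
  · intro w
    fin_cases w
    · exact hsing v
    · exact hpair p q hpq
    · exact hsing r1
    · exact hsing r2
    · exact hsing r3
  · intro a b hab
    rcases lt_or_gt_of_ne hab with h | h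
    · exact hdis a b h
    · exact (hdis b a h).symm
  · intro a b hab
    rcases lt_or_gt_of_ne hab with h | h
    · exact hadj a b h
    · obtain ⟨x, hx, y, hy, hxy⟩ := hadj b a h
      exact ⟨y, hy, x, hx, hxy.symm⟩

lemma pick_pair [DecidableEq V] {H : SimpleGraph V} (N : Finset V) (hN : N.card = 5)
    (h : ∀ x ∈ N, ∀ y ∈ N, ∀ z ∈ N, x ≠ y → x ≠ z → y ≠ z → H.Adj x y ∨ H.Adj x z) :
    ∃ p ∈ N, ∃ q ∈ N, H.Adj p q ∧ ∀ r ∈ N, ∀ r' ∈ N, r ≠ r' → r ≠ p → r ≠ q → r' ≠ p → r' ≠ q →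
      H.Adj r r' := by
  by_cases hall : ∀ x ∈ N, ∀ y ∈ N, x ≠ y → H.Adj x y
  · obtain ⟨p, hp, q, hq, hpq⟩ := Finset.one_lt_card.mp (show 1 < N.card by omega)
    exact ⟨p, hp, q, hq, hall p hp q hq hpq, fun r hr r' hr' hne _ _ _ _ => hall r hr r' hr' hne⟩
  push Not at hall
  obtain ⟨a, ha, b, hb, hab, hnab⟩ := hall
  have hnba : ¬ H.Adj b a := fun h => hnab h.symm
  have hb' : ∀ r ∈ N, r ≠ a → r ≠ b → H.Adj b r := fun r hr h1 h2 =>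
    (h b hb a ha r hr hab.symm h2.symm h1.symm).resolve_left hnba
  have ha' : ∀ r ∈ N, r ≠ a → r ≠ b → H.Adj a r := fun r hr h1 h2 =>
    (h a ha b hb r hr hab h1.symm h2.symm).resolve_left hnab
  by_cases hall2 : ∀ x ∈ N, ∀ y ∈ N, x ≠ a → x ≠ b → y ≠ a → y ≠ b → x ≠ y → H.Adj x y
  · have : (N \ {a, b}).Nonempty := by
      rw [← Finset.card_pos]
      have := Finset.le_card_sdiff {a, b} N
      have := Finset.card_le_two (a := a) (b := b)
      omega
    obtain ⟨c, hc⟩ := this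
    simp only [mem_sdiff, Finset.mem_insert, Finset.mem_singleton, not_or] at hc
    refine ⟨a, ha, c, hc.1, ha' c hc.1 hc.2.1 hc.2.2, ?_⟩
    intro r hr r' hr' hne h1 h2 h3 h4
    by_cases e : r = b
    · subst e; exact hb' r' hr' h3 hne.symm
    by_cases e' : r' = b
    · subst e'; exact (hb' r hr h1 hne).symm
    exact hall2 r hr r' hr' h1 e h3 e' hne
  push Not at hall2
  obtain ⟨c, hc, d, hd, hca, hcb, hda, hdb, hcd, hncd⟩ := hall2
  have hndc : ¬ H.Adj d c := fun h => hncd h.symm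
  have hd' : ∀ r ∈ N, r ≠ c → r ≠ d → H.Adj d r := fun r hr h1 h2 =>
    (h d hd c hc r hr hcd.symm h2.symm h1.symm).resolve_left hndc
  refine ⟨a, ha, c, hc, ha' c hc hca hcb, ?_⟩
  intro r hr r' hr' hne h1 h2 h3 h4
  by_cases e : r = b
  · subst e; exact hb' r' hr' h3 hne.symm
  by_cases e' : r' = b
  · subst e'; exact (hb' r hr h1 hne).symm
  by_cases f : r = d
  · subst f; exact hd' r' hr' h4 hne.symm
  by_cases f' : r' = d
  · subst f'; exact (hd' r hr h2 hne).symm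
  exfalso
  have hsub : ({a, b, c, d, r, r'} : Finset V) ⊆ N := by
    intro x hx
    simp only [Finset.mem_insert, Finset.mem_singleton] at hx
    rcases hx with rfl | rfl | rfl | rfl | rfl | rfl <;> assumption
  have hcard : ({a, b, c, d, r, r'} : Finset V).card = 6 := by
    rw [Finset.card_insert_of_notMem (by grind), Finset.card_insert_of_notMem (by grind),
      Finset.card_insert_of_notMem (by grind), Finset.card_insert_of_notMem (by grind),
      Finset.card_insert_of_notMem (by grind), Finset.card_singleton]
  have := Finset.card_le_card hsub
  omega
end Mader
section Count
variable {V : Type*} [Fintype V]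

/-- Deletion of a vertex, keeping the vertex type. -/
def delv (H : SimpleGraph V) (v : V) : SimpleGraph V where
  Adj x y := H.Adj x y ∧ x ≠ v ∧ y ≠ v
  symm := ⟨fun _ _ h => ⟨h.1.symm, h.2.2, h.2.1⟩⟩
  loopless := ⟨fun _ h => h.1.ne rfl⟩

lemma delv_adj (H : SimpleGraph V) (v x y : V) :
    (delv H v).Adj x y ↔ H.Adj x y ∧ x ≠ v ∧ y ≠ v := Iff.rfl

lemma contr_adj (H : SimpleGraph V) (u v x y : V) :
    (contr H u v).Adj x y ↔ x ≠ y ∧ x ≠ v ∧ y ≠ v ∧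
      (H.Adj x y ∨ (x = u ∧ H.Adj v y) ∨ (y = u ∧ H.Adj v x)) := Iff.rfl

open Classical in
noncomputable def ec (H : SimpleGraph V) : ℕ := H.edgeFinset.card

open Classical in
lemma ec_eq (H : SimpleGraph V) (F : Finset (Sym2 V)) (h : ∀ e, e ∈ H.edgeSet ↔ e ∈ F) :
    ec H = F.card := by
  unfold ec
  congr 1
  ext e
  rw [mem_edgeFinset, h]

open Classical in
lemma ec_delv (H : SimpleGraph V) (v : V) : ec H ≤ ec (delv H v) + H.degree v := by
  unfold ec
  rw [← H.card_incidenceFinset_eq_degree v]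
  refine le_trans (Finset.card_le_card ?_) (Finset.card_union_le _ _)
  intro e
  induction e with
  | _ x y =>
    simp only [mem_union, mem_edgeFinset, mem_edgeSet, mem_incidenceFinset, incidenceSet,
      Set.mem_ofPred_eq, delv_adj, Sym2.mem_iff]
    tauto

open Classical in
lemma ec_contr (H : SimpleGraph V) (u v : V) (huv : H.Adj u v) :
    ec H ≤ ec (contr H u v) + 1 + (H.neighborFinset v ∩ H.neighborFinset u).card := by
  have h1 := ec_delv H v
  let A : Finset V := (H.neighborFinset v \ H.neighborFinset u).erase u
  have hA : H.degree v ≤ A.card + 1 + (H.neighborFinset v ∩ H.neighborFinset u).card := by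
    have a1 := Finset.card_sdiff_add_card_inter (H.neighborFinset v) (H.neighborFinset u)
    have a2 := Finset.pred_card_le_card_erase (s := H.neighborFinset v \ H.neighborFinset u) (a := u)
    rw [H.card_neighborFinset_eq_degree] at a1
    simp only [A]; omega
  have h2 : ec (delv H v) + A.card ≤ ec (contr H u v) := by
    unfold ec
    have hinj : (A.image fun x => s(u, x)).card = A.card := by
      apply Finset.card_image_of_injective
      intro x y h
      exact Sym2.congr_right.mp h
    rw [← hinj, ← Finset.card_union_of_disjoint]
    · apply Finset.card_le_card
      intro e he
      rw [mem_union] at he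
      rcases he with he | he
      · induction e with
        | _ x y =>
          simp only [mem_edgeFinset, mem_edgeSet, delv_adj, contr_adj] at he ⊢
          exact ⟨he.1.ne, he.2.1, he.2.2, Or.inl he.1⟩
      · rw [Finset.mem_image] at he
        obtain ⟨x, hx, rfl⟩ := he
        simp only [A, Finset.mem_erase, mem_sdiff, mem_neighborFinset] at hx
        simp only [mem_edgeFinset, mem_edgeSet, contr_adj]
        exact ⟨hx.1.symm, huv.ne, hx.2.1.ne.symm, Or.inr (Or.inl ⟨trivial, hx.2.1⟩)⟩
    · rw [Finset.disjoint_right]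
      intro e he
      rw [Finset.mem_image] at he
      obtain ⟨x, hx, rfl⟩ := he
      simp only [A, Finset.mem_erase, mem_sdiff, mem_neighborFinset] at hx
      simp only [mem_edgeFinset, mem_edgeSet, delv_adj]
      exact fun h => hx.2.2 h.1
  omega

open Classical in
lemma ec_sum (H : SimpleGraph V) (S : Finset V) (hS : ∀ x y, H.Adj x y → x ∈ S) :
    ∑ x ∈ S, H.degree x = 2 * ec H := by
  unfold ec
  rw [← H.sum_degrees_eq_twice_card_edges]
  apply Finset.sum_subset (Finset.subset_univ _)
  intro x _ hx
  rw [← H.card_neighborFinset_eq_degree, Finset.card_eq_zero, Finset.eq_empty_iff_forall_notMem]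
  intro y hy
  rw [mem_neighborFinset] at hy
  exact hx (hS x y hy)

open Classical in
lemma ec_small (H : SimpleGraph V) (S : Finset V) (hS : ∀ x y, H.Adj x y → x ∈ S) :
    2 * ec H ≤ S.card * (S.card - 1) := by
  rw [← ec_sum H S hS, ← smul_eq_mul]
  apply Finset.sum_le_card_nsmul
  intro x hx
  rw [← Finset.card_erase_of_mem hx, ← H.card_neighborFinset_eq_degree]
  apply Finset.card_le_card
  intro y hy
  rw [mem_neighborFinset] at hy
  rw [Finset.mem_erase]
  exact ⟨hy.ne.symm, hS y x hy.symm⟩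

open Classical in
lemma local_K5 (H : SimpleGraph V) (S : Set V) (hS : ∀ x y, H.Adj x y → x ∈ S) (v : V)
    (hd : H.degree v = 4 ∨ H.degree v = 5)
    (hcom : ∀ x y, H.Adj x y → 3 ≤ (H.neighborFinset x ∩ H.neighborFinset y).card) :
    K5on H S := by
  set N := H.neighborFinset v with hN
  have hNc : N.card = H.degree v := H.card_neighborFinset_eq_degree v
  have hmem : ∀ x, x ∈ N ↔ H.Adj v x := fun x => by rw [hN, mem_neighborFinset]
  have hfin : ∀ p ∈ N, ∀ q ∈ N, (p = q ∨ H.Adj p q) → 3 ≤ (N \ {p, q}).card →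
      (∀ r ∈ N, ∀ r' ∈ N, r ≠ r' → r ≠ p → r ≠ q → r' ≠ p → r' ≠ q → H.Adj r r') →
      (∀ r ∈ N, r ≠ p → r ≠ q → H.Adj r p ∨ H.Adj r q) → K5on H S := by
    intro p hp q hq hpq hc hcl hr
    obtain ⟨R, hR, hRc⟩ := Finset.exists_subset_card_eq hc
    obtain ⟨r1, r2, r3, h12, h13, h23, rfl⟩ := Finset.card_eq_three.mp hRc
    have k : ∀ r ∈ ({r1, r2, r3} : Finset V), r ∈ N ∧ r ≠ p ∧ r ≠ q := by
      intro r hr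
      have := hR hr
      simpa using this
    obtain ⟨a1, b1, c1⟩ := k r1 (by simp)
    obtain ⟨a2, b2, c2⟩ := k r2 (by simp)
    obtain ⟨a3, b3, c3⟩ := k r3 (by simp)
    exact K5on_build hpq ((hmem _).1 hp) ((hmem _).1 hq) ((hmem _).1 a1) ((hmem _).1 a2)
      ((hmem _).1 a3) (hcl _ a1 _ a2 h12 b1 c1 b2 c2) (hcl _ a1 _ a3 h13 b1 c1 b3 c3)
      (hcl _ a2 _ a3 h23 b2 c2 b3 c3) ⟨b1, c1, hr _ a1 b1 c1⟩ ⟨b2, c2, hr _ a2 b2 c2⟩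
      ⟨b3, c3, hr _ a3 b3 c3⟩ hS
  -- non-neighbours inside N
  have hnon : ∀ x ∈ N, ∀ X ⊆ N, x ∈ X → (∀ y ∈ X, ¬ H.Adj x y) → X.card + 3 ≤ N.card := by
    intro x hx X hX hxX hno
    have h3 := hcom v x ((hmem x).1 hx)
    rw [← hN] at h3
    have hdis : Disjoint X (N ∩ H.neighborFinset x) := by
      rw [Finset.disjoint_left]
      intro y hy hy'
      simp only [mem_inter, mem_neighborFinset] at hy'
      exact hno y hy hy'.2
    have := Finset.card_le_card (Finset.union_subset hX (Finset.inter_subset_left (s₁ := N) (s₂ := H.neighborFinset x)))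
    rw [Finset.card_union_of_disjoint hdis] at this
    omega
  rcases hd with hd | hd
  · have hcl : ∀ x ∈ N, ∀ y ∈ N, x ≠ y → H.Adj x y := by
      intro x hx y hy hxy
      by_contra hno
      have := hnon x hx {x, y} (by intro z hz; simp at hz; rcases hz with rfl | rfl <;> assumption)
        (by simp) (by intro z hz; simp at hz; rcases hz with rfl | rfl; exact H.irrefl; exact hno)
      rw [Finset.card_pair hxy] at this
      omega
    obtain ⟨p, hp⟩ : N.Nonempty := by rw [← Finset.card_pos]; omega
    refine hfin p hp p hp (Or.inl rfl) ?_ (fun r hr r' hr' hne _ _ _ _ => hcl r hr r' hr' hne)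
      (fun r hr h1 _ => Or.inl (hcl r hr p hp h1))
    have := Finset.le_card_sdiff {p, p} N
    simp at this
    simp
    omega
  · have h : ∀ x ∈ N, ∀ y ∈ N, ∀ z ∈ N, x ≠ y → x ≠ z → y ≠ z → H.Adj x y ∨ H.Adj x z := by
      intro x hx y hy z hz hxy hxz hyz
      by_contra hno
      push Not at hno
      have := hnon x hx {x, y, z}
        (by intro w hw; simp at hw; rcases hw with rfl | rfl | rfl <;> assumption)
        (by simp) (by
          intro w hw; simp at hw
          rcases hw with rfl | rfl | rfl
          exacts [H.irrefl, hno.1, hno.2])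
      rw [Finset.card_eq_three.mpr ⟨x, y, z, hxy, hxz, hyz, rfl⟩] at this
      omega
    obtain ⟨p, hp, q, hq, hpq, hcl⟩ := pick_pair N (by omega) h
    refine hfin p hp q hq (Or.inr hpq) ?_ hcl (fun r hr h1 h2 => h r hr p hp q hq h1 h2 hpq.ne)
    have := Finset.le_card_sdiff {p, q} N
    have := Finset.card_le_two (a := p) (b := q)
    omega

open Classical in
lemma mader (k : ℕ) : ∀ (S : Finset V) (H : SimpleGraph V) (_ : S.card = k + 3)
    (_ : ∀ x y, H.Adj x y → x ∈ S) (_ : ¬ K5on H (S : Set V)), ec H + 6 ≤ 3 * S.card := by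
  induction k with
  | zero =>
    intro S H hc hS _
    have := ec_small H S hS
    rw [hc] at this ⊢
    omega
  | succ k ih =>
    intro S H₀ hc hS₀ hK₀
    by_contra hcon
    have hle : 3 * S.card - 5 ≤ H₀.edgeFinset.card := by unfold ec at hcon; omega
    obtain ⟨F, hF, hFc⟩ := Finset.exists_subset_card_eq hle
    let H : SimpleGraph V := fromEdgeSet (F : Set (Sym2 V))
    have hHle : H ≤ H₀ := by
      intro x y hxy
      have h1 : s(x, y) ∈ F := by
        have := (fromEdgeSet_adj (s := (F : Set (Sym2 V)))).1 hxy
        exact_mod_cast this.1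
      exact mem_edgeFinset.mp (hF h1)
    have hS : ∀ x y, H.Adj x y → x ∈ S := fun x y h => hS₀ x y (hHle h)
    have hK : ¬ K5on H (S : Set V) := fun h => hK₀ (h.mono hHle (Set.Subset.refl _))
    have hec : ec H + 5 = 3 * S.card := by
      have : ec H = F.card := by
        apply ec_eq
        intro e
        have hd : e ∈ F → ¬ e.IsDiag := fun he =>
          H₀.not_isDiag_of_mem_edgeSet (mem_edgeFinset.mp (hF he))
        simp only [H, edgeSet_fromEdgeSet]
        simp
        exact hd
      rw [this, hFc]; omega
    clear_value H
    have hdel : ∀ v ∈ S, 4 ≤ H.degree v := by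
      intro v hv
      by_contra hlt
      have h1 := ih (S.erase v) (delv H v) (by rw [Finset.card_erase_of_mem hv]; omega)
        (fun x y h => Finset.mem_erase.mpr ⟨h.2.1, hS x y h.1⟩)
        (fun h => hK (h.mono (fun _ _ h => ((delv_adj H v _ _).1 h).1) (by simp)))
      rw [Finset.card_erase_of_mem hv] at h1
      have := ec_delv H v
      omega
    have hcom : ∀ x y, H.Adj x y → 3 ≤ (H.neighborFinset x ∩ H.neighborFinset y).card := by
      intro v u hvu
      by_contra hlt
      have hv : v ∈ S := hS v u hvu
      have h1 := ih (S.erase v) (contr H u v) (by rw [Finset.card_erase_of_mem hv]; omega)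
        (fun x y h => by
          refine Finset.mem_erase.mpr ⟨h.2.1, ?_⟩
          rcases h.2.2.2 with h' | ⟨rfl, h'⟩ | ⟨rfl, h'⟩
          · exact hS x y h'
          · exact hS x v hvu.symm
          · exact hS x v h'.symm)
        (fun h => hK (K5on_of_contr hvu.symm (by exact_mod_cast hv)
          (h.mono le_rfl (by simp))))
      rw [Finset.card_erase_of_mem hv] at h1
      have := ec_contr H u v hvu.symm
      omega
    obtain ⟨v, hv, hv5⟩ : ∃ v ∈ S, H.degree v ≤ 5 := by
      by_contra hno
      push Not at hno
      have h1 := Finset.card_nsmul_le_sum S (fun x => H.degree x) 6 (fun x hx => hno x hx)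
      rw [ec_sum H S hS, smul_eq_mul] at h1
      omega
    have h4 := hdel v hv
    exact hK (local_K5 H S (fun x y h => by exact_mod_cast hS x y h) v (by omega) hcom)

open Classical in
lemma density (S : Finset V) (H : SimpleGraph V) (hS : ∀ x y, H.Adj x y → x ∈ S)
    (hK : ¬ K5on H (S : Set V)) : ec H ≤ 3 * S.card := by
  by_cases h : 3 ≤ S.card
  · have := mader (S.card - 3) S H (by omega) hS hK
    omega
  · have := ec_small H S hS
    have h2 : S.card = 0 ∨ S.card = 1 ∨ S.card = 2 := by omega
    rcases h2 with h2 | h2 | h2 <;> rw [h2] at this ⊢ <;> omega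

open Classical in
lemma exists_orient (G : SimpleGraph V) (hG : ¬ HasMinor G (completeGraph (Fin 5))) :
    ∃ E : V → V → Prop, IsOr G E ∧ ∀ u, od E u ≤ 3 := by
  let t : G.edgeSet → Finset (V × Fin 3) := fun e => Finset.univ.filter fun p => p.1 ∈ (e : Sym2 V)
  have hall : ∀ A : Finset G.edgeSet, A.card ≤ (A.biUnion t).card := by
    intro A
    let F : Finset (Sym2 V) := A.image Subtype.val
    have hFc : F.card = A.card := Finset.card_image_of_injective _ Subtype.val_injective
    have hFG : ∀ e ∈ F, e ∈ G.edgeSet := by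
      intro e he
      obtain ⟨e', _, rfl⟩ := Finset.mem_image.mp he
      exact e'.2
    let H : SimpleGraph V := fromEdgeSet (F : Set (Sym2 V))
    have hHF : ∀ x y, H.Adj x y → s(x, y) ∈ F := by
      intro x y hxy
      have := (fromEdgeSet_adj (s := (F : Set (Sym2 V)))).1 hxy
      exact_mod_cast this.1
    have hHle : H ≤ G := fun x y hxy => hFG _ (hHF x y hxy)
    let S : Finset V := Finset.univ.filter fun x => ∃ e ∈ F, x ∈ e
    have hec : ec H = A.card := by
      have : ec H = F.card := by
        apply ec_eq
        intro e
        have hd : e ∈ F → ¬ e.IsDiag := fun he => G.not_isDiag_of_mem_edgeSet (hFG e he)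
        simp only [H, edgeSet_fromEdgeSet]
        simp
        exact hd
      rw [this, hFc]
    have h1 := density S H (fun x y h => by
      simp only [S, mem_filter, mem_univ, true_and]
      exact ⟨_, hHF x y h, by simp⟩)
      (fun h => hG (h.mono hHle (Set.Subset.refl _)).hasMinor)
    have h2 : A.biUnion t = S ×ˢ (Finset.univ : Finset (Fin 3)) := by
      ext ⟨x, i⟩
      simp [t, S, F]
    rw [h2, Finset.card_product, ← hec]
    simpa [mul_comm] using h1
  obtain ⟨f, hinj, hf⟩ := (Finset.all_card_le_biUnion_card_iff_exists_injective t).mp hall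
  have hf' : ∀ e : G.edgeSet, (f e).1 ∈ (e : Sym2 V) := by
    intro e; have := hf e; simpa [t] using this
  have hcongr : ∀ e e' : G.edgeSet, (e : Sym2 V) = e' → f e = f e' := by
    intro e e' h; rw [Subtype.ext h]
  refine ⟨fun u v => ∃ h : G.Adj u v, (f ⟨s(u, v), h⟩).1 = u, ⟨fun u v => ⟨fun h => ?_, ?_⟩, ?_⟩, ?_⟩
  · have h1 := hf' ⟨s(u, v), h⟩
    rw [Sym2.mem_iff] at h1
    rcases h1 with h1 | h1
    · exact Or.inl ⟨h, h1⟩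
    · refine Or.inr ⟨h.symm, ?_⟩
      exact (congrArg Prod.fst (hcongr ⟨s(v, u), h.symm⟩ ⟨s(u, v), h⟩ Sym2.eq_swap)).trans h1
  · rintro (⟨h, _⟩ | ⟨h, _⟩)
    · exact h
    · exact h.symm
  · rintro u v ⟨⟨h, h1⟩, ⟨h', h2⟩⟩
    have := hcongr ⟨s(u, v), h⟩ ⟨s(v, u), h'⟩ Sym2.eq_swap
    rw [this] at h1
    exact h.ne (h1.symm.trans h2)
  · intro u
    unfold od
    have hex : ∀ v, ∃ i : Fin 3, ∀ h : G.Adj u v, (f ⟨s(u, v), h⟩).2 = i := by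
      intro v
      by_cases h : G.Adj u v
      · exact ⟨(f ⟨s(u, v), h⟩).2, fun _ => rfl⟩
      · exact ⟨0, fun h' => absurd h' h⟩
    choose g hg using hex
    have := Finset.card_le_card_of_injOn (t := (Finset.univ : Finset (Fin 3))) g
      (s := Finset.univ.filter fun v => ∃ h : G.Adj u v, (f ⟨s(u, v), h⟩).1 = u)
      (by intro x _; simp) (by
        intro v hv w hw hvw
        simp only [Finset.coe_filter, mem_univ, true_and, Set.mem_ofPred_eq] at hv hw
        obtain ⟨h1, h1'⟩ := hv
        obtain ⟨h2, h2'⟩ := hw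
        have h3 : f ⟨s(u, v), h1⟩ = f ⟨s(u, w), h2⟩ := by
          apply Prod.ext
          · rw [h1', h2']
          · rw [hg v h1, hg w h2, hvw]
        have := congrArg Subtype.val (hinj h3)
        exact Sym2.congr_right.mp this)
    simpa using this
end Count

theorem stmt13 {V : Type*} [Fintype V] (G : SimpleGraph V)
    (hG : IsPlanar G) (hcol : G.Colorable 3) :
    ∃ o : GOrientation G, o.IsProper ∧ ∀ u, o.outDeg u ≤ 11 := by
  classical
  obtain ⟨C⟩ := hcol
  obtain ⟨E, hE, h3⟩ := exists_orient G hG.1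
  obtain ⟨E', hE', hp, h11⟩ := main_comb (fun v => C v) (fun u v h => C.valid h) E hE h3
  let o : GOrientation G :=
    { dir := fun u v => decide (E' u v)
      adj_iff := fun u v => by simpa using hE'.1 u v
      not_both := fun u v => by simpa using hE'.2 u v }
  have ho : ∀ u, o.outDeg u = od E' u := by
    intro u
    unfold GOrientation.outDeg od
    congr 1
    ext v
    simp [o]
  refine ⟨o, fun u v h => ?_, fun u => ?_⟩
  · rw [ho, ho]; exact hp u v h
  · rw [ho]; exact h11 u
end
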